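/- arXiv:0905.0136 — 5 statements merged into one kernel-verified Lean document; each statement's English description precedes it below -/
import Mathlib

section
/- For every sequence (g_n)_{n≥1} in Homeo⁺(S¹) there exists a subsequence (g_{n_k})_{k≥1} and a map s : S¹ → S¹ such that for every m ∈ S¹ the sequence g_{n_k}(m) converges to s(m). -/
open Filter

noncomputable section

/-- The circle `S¹ = ℝ/ℤ`. -/
abbrev S1 : Type := AddCircle (1 : ℝ)

/-- `F : ℝ → ℝ` is an increasing homeomorphism of `ℝ` commuting with integer
translations which is a lift of `f : S¹ → S¹`. -/
def IsCircleLift (f : S1 → S1) (F : ℝ → ℝ) : Prop :=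
  StrictMono F ∧ Function.Surjective F ∧ (∀ x, F (x + 1) = F x + 1) ∧
    ∀ x : ℝ, f (x : S1) = (F x : S1)

/-- `f` is an orientation preserving homeomorphism of the circle. -/
def IsOPH (f : S1 → S1) : Prop := ∃ F, IsCircleLift f F

/-- **Helly's selection theorem**: a pointwise relatively compact sequence of monotone functions
`ℝ → ℝ` has a pointwise convergent subsequence. -/
theorem exists_strictMono_tendsto_of_monotone {F : ℕ → ℝ → ℝ} (hF : ∀ n, Monotone (F n))
    (hK : ∀ x, ∃ K, IsCompact K ∧ ∀ n, F n x ∈ K) :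
    ∃ φ : ℕ → ℕ, StrictMono φ ∧ ∃ G : ℝ → ℝ,
      ∀ x, Tendsto (fun k => F (φ k) x) atTop (nhds (G x)) := by
  have hlim : ∀ x, ∃ y, Tendsto (fun n => F n x) (hyperfilter ℕ) (nhds y) := by
    intro x
    obtain ⟨K, hKc, hmem⟩ := hK x
    obtain ⟨y, -, hy⟩ := hKc.ultrafilter_le_nhds ((hyperfilter ℕ).map fun n => F n x)
      (le_principal_iff.2 (mem_map.2 (univ_mem' hmem)))
    exact ⟨y, hy⟩
  choose G hG using hlim
  have hGmono : Monotone G := fun x y hxy =>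
    le_of_tendsto_of_tendsto' (hG x) (hG y) fun n => hF n hxy
  let D : Set ℝ := Set.range ((↑) : ℚ → ℝ) ∪ {x | ¬ContinuousAt G x}
  have hD : D.Countable := (Set.countable_range _).union hGmono.countable_not_continuousAt
  have : Countable D := hD.to_subtype
  have hcl : MapClusterPt (fun x : D => G x) atTop (fun n (x : D) => F n x) := by
    have h : Tendsto (fun n (x : D) => F n x) (hyperfilter ℕ) (nhds fun x : D => G x) :=
      tendsto_pi_nhds.2 fun x => hG x
    exact h.mapClusterPt.mono Nat.hyperfilter_le_atTop
  obtain ⟨φ, hφ, hconv⟩ := hcl.tendsto_subseq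
  have hconvD : ∀ x ∈ D, Tendsto (fun k => F (φ k) x) atTop (nhds (G x)) := fun x hx =>
    tendsto_pi_nhds.1 hconv ⟨x, hx⟩
  refine ⟨φ, hφ, G, fun x => ?_⟩
  by_cases hx : ContinuousAt G x
  · refine tendsto_order.2 ⟨fun a ha => ?_, fun a ha => ?_⟩
    · obtain ⟨l, hl, hsub⟩ := exists_Ioc_subset_of_mem_nhds (hx.eventually_const_lt ha)
        (exists_lt x)
      obtain ⟨q, hlq, hqx⟩ := exists_rat_btwn hl
      have hq : a < G q := hsub ⟨hlq, hqx.le⟩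
      filter_upwards [(hconvD q (Or.inl ⟨q, rfl⟩)).eventually_const_lt hq] with k hk
      exact hk.trans_le (hF _ hqx.le)
    · obtain ⟨u, hu, hsub⟩ := exists_Ico_subset_of_mem_nhds (hx.eventually_lt_const ha)
        (exists_gt x)
      obtain ⟨q, hxq, hqu⟩ := exists_rat_btwn hu
      have hq : G q < a := hsub ⟨hxq.le, hqu⟩
      filter_upwards [(hconvD q (Or.inl ⟨q, rfl⟩)).eventually_lt_const hq] with k hk
      exact (hF _ hxq.le).trans_lt hk
  · exact hconvD x (Or.inr hx)

/-- An orientation preserving circle homeomorphism has a degree one lift sending `0` into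
`[0, 1)`. -/
theorem IsOPH.exists_normalized_lift {f : S1 → S1} (hf : IsOPH f) :
    ∃ F : CircleDeg1Lift, F 0 ∈ Set.Ico (0 : ℝ) 1 ∧ ∀ x : ℝ, f (x : S1) = (F x : S1) := by
  obtain ⟨F, hmono, -, hadd, hlift⟩ := hf
  refine ⟨⟨⟨fun x => F x - ⌊F 0⌋, fun x y h => sub_le_sub_right (hmono.monotone h) _⟩,
    fun x => ?_⟩, ⟨Int.fract_nonneg (F 0), Int.fract_lt_one (F 0)⟩, fun x => ?_⟩
  · change F (x + 1) - ⌊F 0⌋ = F x - ⌊F 0⌋ + 1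
    rw [hadd]
    ring
  · change f (x : S1) = ((F x - ⌊F 0⌋ : ℝ) : S1)
    have h : ((⌊F 0⌋ : ℝ) : S1) = 0 := (AddCircle.coe_eq_zero_iff (1 : ℝ)).2 ⟨⌊F 0⌋, by simp⟩
    rw [hlift, AddCircle.coe_sub, h, sub_zero]

/-- Every sequence in `Homeo⁺(S¹)` admits a pointwise convergent subsequence. -/
theorem oph_seq_has_pointwise_convergent_subsequence
    (g : ℕ → S1 → S1) (hg : ∀ n, IsOPH (g n)) :
    ∃ n : ℕ → ℕ, StrictMono n ∧ ∃ s : S1 → S1,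
      ∀ m : S1, Tendsto (fun k => g (n k) m) atTop (nhds (s m)) := by
  choose F hF0 hlift using fun n => (hg n).exists_normalized_lift
  obtain ⟨n, hn, G, hG⟩ := exists_strictMono_tendsto_of_monotone (F := fun n => F n)
    (fun n => (F n).monotone) fun x => ⟨Set.Icc ⌊x⌋ (1 + ⌈x⌉), isCompact_Icc, fun n =>
      ⟨by linarith [(F n).le_map_of_map_zero x, (hF0 n).1],
        by linarith [(F n).map_le_of_map_zero x, (hF0 n).2]⟩⟩
  choose r hr using fun m : S1 => QuotientAddGroup.mk_surjective m
  refine ⟨n, hn, fun m => (G (r m) : S1), fun m => ?_⟩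
  have h := ((AddCircle.continuous_mk' (1 : ℝ)).tendsto _).comp (hG (r m))
  exact h.congr fun k => by rw [← congrArg (g (n k)) (hr m), hlift]; rfl

end
end

section
/- Let K be a complete nontrivially normed field whose closed unit ball is compact, and let V be a nonzero finite-dimensional K-vector space. For every sequence (g_n)_{n≥1} in GL(V) there exists a subsequence (g_{n_k})_{k≥1} and a map s : ℙ(V) → ℙ(V) such that for every point L of the projective space ℙ(V), the sequence of points g_{n_k}·L converges to s(L) in ℙ(V). -/
open Filter

noncomputable section

variable {K V : Type*} [NontriviallyNormedField K] [NormedAddCommGroup V] [NormedSpace K V]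

/-- The projectivization of `V` equipped with the quotient topology from `V ∖ {0}`. -/
instance Projectivization.instTopologicalSpace :
    TopologicalSpace (Projectivization K V) :=
  TopologicalSpace.coinduced (Projectivization.mk' K)
    (inferInstance : TopologicalSpace {v : V // v ≠ 0})

/-- The action of `GL(V)` on `ℙ(V)`: `g · (span v) = span (g v)`. -/
def projAction (g : V ≃ₗ[K] V) : Projectivization K V → Projectivization K V :=
  Projectivization.map (g : V →ₗ[K] V) g.injective

theorem Projectivization.continuous_mk' :
    Continuous (Projectivization.mk' K : {v : V // v ≠ 0} → Projectivization K V) :=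
  continuous_coinduced_rng

theorem Projectivization.tendsto_mk {ι : Type*} {l : Filter ι} {u : ι → V} {a : V}
    (hu : ∀ i, u i ≠ 0) (ha : a ≠ 0) (h : Tendsto u l (nhds a)) :
    Tendsto (fun i => Projectivization.mk K (u i) (hu i)) l (nhds (Projectivization.mk K a ha)) :=
  (Projectivization.continuous_mk'.tendsto ⟨a, ha⟩).comp
    (tendsto_subtype_rng.2 h : Tendsto (fun i => (⟨u i, hu i⟩ : {v : V // v ≠ 0})) l _)

theorem properSpace_of_isCompact_closedBall (hK : IsCompact (Metric.closedBall (0 : K) 1)) :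
    ProperSpace K :=
  have : LocallyCompactSpace K :=
    hK.locallyCompactSpace_of_mem_nhds_of_addGroup (Metric.closedBall_mem_nhds _ one_pos)
  ProperSpace.of_locallyCompactSpace K

/-- In a proper normed space, a sequence of nonzero vectors can be rescaled so that a subsequence
converges to a nonzero vector. -/
theorem exists_subseq_smul_tendsto_ne_zero {E : Type*} [NormedAddCommGroup E] [NormedSpace K E]
    [ProperSpace E] {f : ℕ → E} (hf : ∀ k, f k ≠ 0) :
    ∃ d : ℕ → K, (∀ k, d k ≠ 0) ∧ ∃ a ≠ 0, ∃ n : ℕ → ℕ, StrictMono n ∧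
      Tendsto (fun k => d (n k) • f (n k)) atTop (nhds a) := by
  obtain ⟨c, hc⟩ := NormedField.exists_one_lt_norm K
  choose d hd hlt hle _ using fun k => rescale_to_shell hc one_pos (hf k)
  have hcompact : IsCompact (Metric.closedBall (0 : E) 1 ∩ {x | 1 / ‖c‖ ≤ ‖x‖}) :=
    (isCompact_closedBall 0 1).inter_right (isClosed_le continuous_const continuous_norm)
  obtain ⟨a, ha, n, hn, hlim⟩ := hcompact.tendsto_subseq (x := fun k => d k • f k)
    fun k => ⟨by simpa using (hlt k).le, hle k⟩
  have hpos : 0 < 1 / ‖c‖ := by positivity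
  exact ⟨d, hd, a, norm_pos_iff.1 (hpos.trans_le ha.2), n, hn, hlim⟩

theorem projAction_mk_eq_mk_smul (g : V ≃ₗ[K] V) {v : V} (hv : v ≠ 0) {d : K} (hd : d ≠ 0) :
    projAction g (Projectivization.mk K v hv) =
      Projectivization.mk K (d • g v) (smul_ne_zero hd (g.map_ne_zero_iff.2 hv)) := by
  rw [projAction, Projectivization.map_mk, Projectivization.mk_eq_mk_iff']
  exact ⟨d⁻¹, by simp [smul_smul, hd]⟩

theorem exists_subseq_projAction_tendsto_on_submodule [CompleteSpace K] [ProperSpace K]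
    [FiniteDimensional K V] (W : Submodule K V) (g : ℕ → V ≃ₗ[K] V) :
    ∃ n : ℕ → ℕ, StrictMono n ∧ ∀ (v : V) (hv : v ≠ 0), v ∈ W → ∃ p : Projectivization K V,
      Tendsto (fun k => projAction (g (n k)) (Projectivization.mk K v hv)) atTop (nhds p) := by
  induction W using WellFoundedLT.induction generalizing g with
  | ind W ih =>
  rcases eq_or_ne W ⊥ with rfl | hW
  · exact ⟨id, strictMono_id, fun v hv hvW => absurd ((Submodule.mem_bot K).1 hvW) hv⟩
  obtain ⟨w, hwW, hw⟩ := W.exists_mem_ne_zero_of_ne_bot hW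
  let f : ℕ → W →L[K] V := fun k =>
    LinearMap.toContinuousLinearMap ((g k : V →ₗ[K] V) ∘ₗ W.subtype)
  have hf : ∀ k, f k ≠ 0 := fun k h =>
    (g k).map_ne_zero_iff.2 hw (DFunLike.congr_fun h (⟨w, hwW⟩ : W))
  have : ProperSpace (W →L[K] V) := FiniteDimensional.proper K _
  obtain ⟨d, hd, T, hT, n, hn, hlim⟩ := exists_subseq_smul_tendsto_ne_zero (K := K) hf
  have hlt : (LinearMap.ker (T : W →ₗ[K] V)).map W.subtype < W := by
    refine lt_of_le_of_ne (Submodule.map_subtype_le _ _) fun h => hT ?_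
    ext x
    obtain ⟨y, hy, hyx⟩ := h.ge x.2
    obtain rfl : y = x := Subtype.ext hyx
    exact hy
  obtain ⟨m, hm, hker⟩ := ih _ hlt (g ∘ n)
  refine ⟨n ∘ m, hn.comp hm, fun v hv hvW => ?_⟩
  by_cases hTv : T ⟨v, hvW⟩ = 0
  · exact hker v hv ⟨⟨v, hvW⟩, hTv, rfl⟩
  · refine ⟨Projectivization.mk K _ hTv, ?_⟩
    simp_rw [fun k => projAction_mk_eq_mk_smul (g ((n ∘ m) k)) hv (hd ((n ∘ m) k))]
    refine Projectivization.tendsto_mk _ hTv ?_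
    exact (((ContinuousLinearMap.apply K V (⟨v, hvW⟩ : W)).continuous.tendsto T).comp
      hlim).comp hm.tendsto_atTop

/-- Let `K` be a complete nontrivially normed field with compact closed unit ball and
`V ≠ 0` a finite dimensional `K`-vector space.  Every sequence in `GL(V)` admits a
subsequence acting pointwise convergently on `ℙ(V)`. -/
theorem gl_seq_has_pointwise_convergent_subsequence_on_proj
    [CompleteSpace K] (hK : IsCompact (Metric.closedBall (0 : K) 1))
    [FiniteDimensional K V] [Nontrivial V]
    (g : ℕ → V ≃ₗ[K] V) :
    ∃ n : ℕ → ℕ, StrictMono n ∧ ∃ s : Projectivization K V → Projectivization K V,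
      ∀ L : Projectivization K V,
        Tendsto (fun k => projAction (g (n k)) L) atTop (nhds (s L)) := by
  have := properSpace_of_isCompact_closedBall hK
  obtain ⟨n, hn, h⟩ := exists_subseq_projAction_tendsto_on_submodule ⊤ g
  choose s hs using fun L : Projectivization K V => h L.rep L.rep_nonzero Submodule.mem_top
  exact ⟨n, hn, s, fun L => by simpa only [Projectivization.mk_rep] using hs L⟩

end
end

section
/- Let Γ be a group and ρ : Γ → Homeo⁺(S¹) a homomorphism. There exists no bounded function β : Γ → ℝ with c(ρ(γ),ρ(η)) = β(γ) − β(γη) + β(η) for all γ, η ∈ Γ (i.e. the real bounded Euler class of ρ is nonzero) if and only if ρ is quasi-conjugate to a minimal unbounded action Γ → Homeo⁺(S¹). -/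
open Filter MeasureTheory Set
open scoped Classical

noncomputable section

/-- The unique lift `f̄` of `f ∈ Homeo⁺(S¹)` with `f̄ 0 ∈ [0,1)`. -/
def posLift (f : S1 → S1) : ℝ → ℝ :=
  if h : ∃ F, IsCircleLift f F ∧ F 0 ∈ Set.Ico (0 : ℝ) 1 then h.choose else id

/-- The Euler cocycle `c(f,g)`, defined by `f̄(ḡ(x)) = (f∘g)‾(x) + c(f,g)` where
`f̄` denotes the lift of `f` with `f̄ 0 ∈ [0,1)`. -/
def euler (f g : S1 → S1) : ℝ :=
  posLift f (posLift g 0) - posLift (fun x => f (g x)) 0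

/-- A quasi-conjugacy: a self-map of the circle induced by a monotone increasing
map of `ℝ` commuting with integer translations. -/
def IsQuasiConjMap (h : S1 → S1) : Prop :=
  ∃ H : ℝ → ℝ, Monotone H ∧ (∀ x, H (x + 1) = H x + 1) ∧ ∀ x : ℝ, h (x : S1) = (H x : S1)

/-- `ρ₀` and `ρ₁` are quasi-conjugate: there is a quasi-conjugacy `h` with
`h ∘ ρ₀ γ = ρ₁ γ ∘ h` for all `γ`. -/
def QuasiConj {Γ : Type*} (ρ₀ ρ₁ : Γ → S1 → S1) : Prop :=
  ∃ h, IsQuasiConjMap h ∧ ∀ γ, h ∘ ρ₀ γ = ρ₁ γ ∘ h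

/-- `ρ` is an action of `Γ` on the circle by orientation preserving homeomorphisms,
i.e. a homomorphism `Γ → Homeo⁺(S¹)`. -/
def IsCircleAction (Γ : Type*) [Group Γ] (ρ : Γ → S1 → S1) : Prop :=
  (∀ γ, IsOPH (ρ γ)) ∧ ρ 1 = id ∧ ∀ γ η, ρ (γ * η) = ρ γ ∘ ρ η

/-- The real bounded Euler class of `ρ` vanishes: the Euler cocycle of `ρ` is the
coboundary of a bounded real-valued function on `Γ`. -/
def RealEulerVanishes {Γ : Type*} [Group Γ] (ρ : Γ → S1 → S1) : Prop :=
  ∃ β : Γ → ℝ, (∃ C : ℝ, ∀ γ, |β γ| ≤ C) ∧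
    ∀ γ η : Γ, euler (ρ γ) (ρ η) = β γ - β (γ * η) + β η

/-- Every orbit of the action is dense. -/
def MinimalAction {Γ : Type*} (ρ : Γ → S1 → S1) : Prop :=
  ∀ x : S1, Dense (Set.range fun γ => ρ γ x)

/-- The family of homeomorphisms `ρ(Γ)` is not equicontinuous. -/
def UnboundedAction {Γ : Type*} (ρ : Γ → S1 → S1) : Prop :=
  ¬ Equicontinuous fun γ => ρ γ

theorem S1.coe_eq_coe_iff {a b : ℝ} : (a : S1) = (b : S1) ↔ ∃ n : ℤ, a = b + n := by
  rw [← sub_eq_zero, ← AddCircle.coe_sub, AddCircle.coe_eq_zero_iff]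
  constructor
  · rintro ⟨n, hn⟩
    refine ⟨n, ?_⟩
    rw [zsmul_one] at hn
    linarith
  · rintro ⟨n, hn⟩
    refine ⟨n, ?_⟩
    rw [zsmul_one]
    linarith

theorem S1.coe_add_int (a : ℝ) (n : ℤ) : ((a + n : ℝ) : S1) = a :=
  S1.coe_eq_coe_iff.2 ⟨n, rfl⟩

theorem map_add_int_of_map_add_one {H : ℝ → ℝ} (h : ∀ x, H (x + 1) = H x + 1) (x : ℝ) (n : ℤ) :
    H (x + n) = H x + n := by
  have hp : Function.Periodic (fun x => H x - x) 1 := fun x => by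
    show H (x + 1) - (x + 1) = H x - x
    rw [h]; ring
  have := hp.int_mul n x
  simp only [mul_one] at this
  linarith

/-- Two continuous real functions inducing the same circle-valued function differ by an integer. -/
theorem exists_int_eq_add_of_coe_eq {A B : ℝ → ℝ} (hA : Continuous A) (hB : Continuous B)
    (h : ∀ x, (A x : S1) = (B x : S1)) : ∃ n : ℤ, ∀ x, A x = B x + n := by
  choose k hk using fun x => S1.coe_eq_coe_iff.1 (h x)
  have hc : Continuous k := by
    have : Continuous fun x => (k x : ℝ) := by
      have e : (fun x => (k x : ℝ)) = fun x => A x - B x := by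
        funext x
        linarith [hk x]
      rw [e]
      exact hA.sub hB
    exact Int.isClosedEmbedding_coe_real.isEmbedding.continuous_iff.2 this
  refine ⟨k 0, fun x => ?_⟩
  rw [hk x, PreconnectedSpace.constant inferInstance hc (x := x) (y := 0)]

namespace IsCircleLift

variable {f g : S1 → S1} {F G : ℝ → ℝ}

theorem strictMono (h : IsCircleLift f F) : StrictMono F := h.1

theorem surjective (h : IsCircleLift f F) : Function.Surjective F := h.2.1

theorem map_add_one (h : IsCircleLift f F) (x : ℝ) : F (x + 1) = F x + 1 := h.2.2.1 x

theorem map_coe (h : IsCircleLift f F) (x : ℝ) : f (x : S1) = (F x : S1) := h.2.2.2 x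

theorem continuous (h : IsCircleLift f F) : Continuous F :=
  h.strictMono.monotone.continuous_of_surjective h.surjective

theorem map_add_int (h : IsCircleLift f F) (x : ℝ) (n : ℤ) : F (x + n) = F x + n :=
  map_add_int_of_map_add_one h.map_add_one x n

theorem add_int (h : IsCircleLift f F) (n : ℤ) : IsCircleLift f fun x => F x + n := by
  refine ⟨fun x y hxy => by simpa using h.strictMono hxy, fun y => ?_, fun x => ?_, fun x => ?_⟩
  · obtain ⟨x, hx⟩ := h.surjective (y - n)
    exact ⟨x, by simp [hx]⟩
  · simp only [h.map_add_one]; ring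
  · rw [S1.coe_add_int, h.map_coe]

theorem comp (hf : IsCircleLift f F) (hg : IsCircleLift g G) :
    IsCircleLift (f ∘ g) (F ∘ G) := by
  refine ⟨hf.strictMono.comp hg.strictMono, hf.surjective.comp hg.surjective, fun x => ?_,
    fun x => ?_⟩
  · simp [hg.map_add_one, hf.map_add_one]
  · simp [hg.map_coe, hf.map_coe]

theorem exists_int_eq (hF : IsCircleLift f F) (hG : IsCircleLift f G) :
    ∃ n : ℤ, ∀ x, F x = G x + n :=
  exists_int_eq_add_of_coe_eq hF.continuous hG.continuous fun x => by
    rw [← hF.map_coe, ← hG.map_coe]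

end IsCircleLift

theorem isCircleLift_add_int (n : ℤ) : IsCircleLift id fun x => x + n :=
  IsCircleLift.add_int ⟨strictMono_id, Function.surjective_id, fun _ => rfl, fun _ => rfl⟩ n

theorem isCircleLift_id : IsCircleLift id id :=
  ⟨strictMono_id, Function.surjective_id, fun _ => rfl, fun _ => rfl⟩

theorem posLift_spec {f : S1 → S1} (hf : IsOPH f) :
    IsCircleLift f (posLift f) ∧ posLift f 0 ∈ Set.Ico (0 : ℝ) 1 := by
  have h : ∃ F, IsCircleLift f F ∧ F 0 ∈ Set.Ico (0 : ℝ) 1 := by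
    obtain ⟨F, hF⟩ := hf
    refine ⟨_, hF.add_int (-⌊F 0⌋), ?_⟩
    have e : F 0 + ((-⌊F 0⌋ : ℤ) : ℝ) = Int.fract (F 0) := by
      rw [Int.cast_neg, ← sub_eq_add_neg]; rfl
    simp only [e]
    exact ⟨Int.fract_nonneg _, Int.fract_lt_one _⟩
  rw [posLift, dif_pos h]
  exact h.choose_spec

theorem posLift_posLift {f g : S1 → S1} (hf : IsOPH f) (hg : IsOPH g) (x : ℝ) :
    posLift f (posLift g x) = posLift (f ∘ g) x + euler f g := by
  have hf' := (posLift_spec hf).1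
  have hg' := (posLift_spec hg).1
  have hfg := (posLift_spec ⟨_, hf'.comp hg'⟩).1
  obtain ⟨n, hn⟩ := (hf'.comp hg').exists_int_eq hfg
  have h0 := hn 0
  have hx := hn x
  simp only [Function.comp_apply] at h0 hx
  have e : euler f g = n := by
    have : euler f g = posLift f (posLift g 0) - posLift (f ∘ g) 0 := rfl
    rw [this, h0]; ring
  rw [hx, e]

namespace IsCircleAction

variable {Γ : Type*} [Group Γ] {ρ : Γ → S1 → S1} {γ η : Γ} {F G : ℝ → ℝ}

theorem lift_comp (hρ : IsCircleAction Γ ρ) (hF : IsCircleLift (ρ γ) F)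
    (hG : IsCircleLift (ρ η) G) : IsCircleLift (ρ (γ * η)) (F ∘ G) := by
  rw [hρ.2.2]
  exact hF.comp hG

theorem lift_add_int (hρ : IsCircleAction Γ ρ) (n : ℤ) : IsCircleLift (ρ 1) fun x => x + n := by
  rw [hρ.2.1]
  exact isCircleLift_add_int n

theorem lift_id (hρ : IsCircleAction Γ ρ) : IsCircleLift (ρ 1) id := by
  rw [hρ.2.1]
  exact isCircleLift_id

theorem exists_lift_inv (hρ : IsCircleAction Γ ρ) (hF : IsCircleLift (ρ γ) F) :
    ∃ G, IsCircleLift (ρ γ⁻¹) G ∧ (∀ x, F (G x) = x) ∧ ∀ x, G (F x) = x := by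
  obtain ⟨G₀, hG₀⟩ := hρ.1 γ⁻¹
  have h1 : IsCircleLift (ρ 1) (F ∘ G₀) := by
    have := hρ.lift_comp hF hG₀
    rwa [mul_inv_cancel] at this
  obtain ⟨n, hn⟩ := h1.exists_int_eq hρ.lift_id
  simp only [Function.comp_apply, id] at hn
  have hFG : ∀ x, F (G₀ x + ((-n : ℤ) : ℝ)) = x := fun x => by
    rw [hF.map_add_int, hn]; push_cast; ring
  exact ⟨_, hG₀.add_int (-n), hFG, fun x => hF.strictMono.injective (hFG (F x))⟩

theorem map_one_apply (hρ : IsCircleAction Γ ρ) (z : S1) : ρ 1 z = z := by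
  rw [hρ.2.1]; rfl

theorem map_mul_apply (hρ : IsCircleAction Γ ρ) (γ η : Γ) (z : S1) :
    ρ (γ * η) z = ρ γ (ρ η z) := by
  rw [hρ.2.2]; rfl

end IsCircleAction

/-- The action `ρ` is semi-conjugate, at the level of lifts, to an action by rotations. -/
def HasRotationFactor {Γ : Type*} (ρ : Γ → S1 → S1) : Prop :=
  ∃ K : ℝ → ℝ, Monotone K ∧ (∀ x, K (x + 1) = K x + 1) ∧
    ∀ γ F, IsCircleLift (ρ γ) F → ∀ x y, K (F y) - K (F x) = K y - K x

theorem realEulerVanishes_iff_hasRotationFactor {Γ : Type*} [Group Γ] {ρ : Γ → S1 → S1}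
    (hρ : IsCircleAction Γ ρ) : RealEulerVanishes ρ ↔ HasRotationFactor ρ := by
  have hmul : ∀ γ η x, posLift (ρ γ) (posLift (ρ η) x) =
      posLift (ρ (γ * η)) x + euler (ρ γ) (ρ η) := fun γ η x => by
    rw [hρ.2.2, posLift_posLift (hρ.1 γ) (hρ.1 η)]
  have hl := fun γ => posLift_spec (hρ.1 γ)
  constructor
  · rintro ⟨β, ⟨C, hC⟩, hβ⟩
    have hbdd : ∀ x, BddAbove (range fun γ => posLift (ρ γ) x - β γ) := fun x => by
      refine ⟨1 + |(⌈x⌉ : ℝ)| + C, ?_⟩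
      rintro _ ⟨γ, rfl⟩
      have h1 := (hl γ).1.strictMono.monotone (Int.le_ceil x)
      have h2 := (hl γ).1.map_add_int 0 ⌈x⌉
      rw [zero_add] at h2
      have h3 := (hl γ).2.2
      have h4 := (abs_le.1 (hC γ)).1
      have h5 := le_abs_self (⌈x⌉ : ℝ)
      simp only
      linarith
    have key : ∀ η x, (⨆ γ, (posLift (ρ γ) (posLift (ρ η) x) - β γ)) =
        (⨆ γ, (posLift (ρ γ) x - β γ)) + β η := fun η x => by
      rw [ciSup_add (hbdd x)]
      rw [← (Equiv.mulRight η).iSup_comp (g := fun γ => posLift (ρ γ) x - β γ + β η)]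
      congr 1
      funext γ
      rw [hmul, hβ]
      simp only [Equiv.coe_mulRight]
      ring
    have hone : ∀ (x : ℝ) (n : ℤ), (⨆ γ, (posLift (ρ γ) (x + n) - β γ)) =
        (⨆ γ, (posLift (ρ γ) x - β γ)) + n := fun x n => by
      rw [ciSup_add (hbdd x)]
      congr 1
      funext γ
      rw [(hl γ).1.map_add_int]
      ring
    refine ⟨fun x => ⨆ γ, (posLift (ρ γ) x - β γ), fun x y hxy => ?_, fun x => ?_,
      fun γ F hF x y => ?_⟩
    · exact ciSup_mono (hbdd y) fun γ => sub_le_sub_right ((hl γ).1.strictMono.monotone hxy) _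
    · simpa using hone x 1
    · obtain ⟨n, hn⟩ := hF.exists_int_eq (hl γ).1
      simp only [hn, hone, key]
      ring
  · rintro ⟨K, hK, hK1, hKF⟩
    refine ⟨fun γ => K (posLift (ρ γ) 0) - K 0, ⟨1, fun γ => ?_⟩, fun γ η => ?_⟩
    · have h1 := hK (hl γ).2.1
      have h2 := hK (hl γ).2.2.le
      have h3 := hK1 0
      rw [zero_add] at h3
      rw [abs_le]
      constructor <;> linarith
    · have h1 := hmul γ η 0
      have h2 := hKF γ _ (hl γ).1 0 (posLift (ρ η) 0)
      obtain ⟨n, hn⟩ := ((hl γ).1.comp (hl η).1).exists_int_eq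
        (by rw [← hρ.2.2]; exact (hl (γ * η)).1)
      have h3 := hn 0
      simp only [Function.comp_apply] at h3
      have h4 : euler (ρ γ) (ρ η) = n := by linarith
      rw [h3, map_add_int_of_map_add_one hK1] at h2
      simp only [h4]
      linarith

theorem Dense.preimage_coe_real {s : Set S1} (hs : Dense s) :
    Dense ((fun x : ℝ => (x : S1)) ⁻¹' s) :=
  hs.preimage QuotientAddGroup.isOpenMap_coe

theorem MinimalAction.dense_lift {Γ : Type*} [Group Γ] {ρ : Γ → S1 → S1}
    (hρ : IsCircleAction Γ ρ) (hmin : MinimalAction ρ) (x : ℝ) :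
    Dense {y | ∃ γ F, IsCircleLift (ρ γ) F ∧ F x = y} := by
  refine (hmin x).preimage_coe_real.mono ?_
  rintro y ⟨γ, hγ⟩
  obtain ⟨F, hF⟩ := hρ.1 γ
  simp only [hF.map_coe] at hγ
  obtain ⟨n, hn⟩ := S1.coe_eq_coe_iff.1 hγ.symm
  exact ⟨γ, _, hF.add_int n, hn.symm⟩

theorem MinimalAction.exists_lift_mem {Γ : Type*} [Group Γ] {ρ : Γ → S1 → S1}
    (hρ : IsCircleAction Γ ρ) (hmin : MinimalAction ρ) (x : ℝ) {U : Set ℝ} (hU : IsOpen U)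
    (hne : U.Nonempty) : ∃ γ F, IsCircleLift (ρ γ) F ∧ F x ∈ U := by
  obtain ⟨_, hy, γ, F, hF, rfl⟩ := (MinimalAction.dense_lift hρ hmin x).inter_open_nonempty U hU hne
  exact ⟨γ, F, hF, hy⟩

/-- A quasi-conjugacy onto a minimal action lifts to a continuous map intertwining lifts. -/
theorem QuasiConj.exists_continuous_lift {Γ : Type*} [Group Γ] {ρ ρ₁ : Γ → S1 → S1}
    (hmin : MinimalAction ρ₁) (h : QuasiConj ρ ρ₁) :
    ∃ H : ℝ → ℝ, Continuous H ∧ Monotone H ∧ (∀ x, H (x + 1) = H x + 1) ∧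
      ∀ γ F G, IsCircleLift (ρ γ) F → IsCircleLift (ρ₁ γ) G →
        ∃ n : ℤ, ∀ x, H (F x) = G (H x) + n := by
  obtain ⟨h, ⟨H, hmono, hone, hH⟩, hconj⟩ := h
  have hdense : DenseRange H := by
    have h1 : Dense (range h) := (hmin (h 0)).mono <| by
      rintro _ ⟨γ, rfl⟩
      exact ⟨ρ γ 0, congrFun (hconj γ) 0⟩
    refine h1.preimage_coe_real.mono ?_
    rintro y ⟨z, hz⟩
    obtain ⟨x, rfl⟩ := QuotientAddGroup.mk_surjective z
    obtain ⟨n, hn⟩ := S1.coe_eq_coe_iff.1 (hz.symm.trans (hH x))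
    exact ⟨x + n, by rw [map_add_int_of_map_add_one hone, hn]⟩
  have hcont := hmono.continuous_of_denseRange hdense
  refine ⟨H, hcont, hmono, hone, fun γ F G hF hG => ?_⟩
  refine exists_int_eq_add_of_coe_eq (hcont.comp hF.continuous) (hG.continuous.comp hcont)
    fun x => ?_
  have := congrFun (hconj γ) x
  simp only [Function.comp_apply, hF.map_coe, hH, hG.map_coe] at this
  exact this

theorem QuasiConj.hasRotationFactor_iff {Γ : Type*} [Group Γ] {ρ ρ₁ : Γ → S1 → S1}
    (hρ : IsCircleAction Γ ρ) (hρ₁ : IsCircleAction Γ ρ₁) (hmin : MinimalAction ρ₁)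
    (h : QuasiConj ρ ρ₁) : HasRotationFactor ρ ↔ HasRotationFactor ρ₁ := by
  obtain ⟨H, hcont, hmono, hone, hconj⟩ := h.exists_continuous_lift hmin
  constructor
  · rintro ⟨K, hK, hK1, hKF⟩
    have hKn := map_add_int_of_map_add_one hK1
    have hHn := map_add_int_of_map_add_one hone
    have hne : ∀ t, (K '' {x | H x ≤ t}).Nonempty := fun t => by
      refine ⟨_, ((⌊t - H 0⌋ : ℤ) : ℝ), ?_, rfl⟩
      have := hHn 0 ⌊t - H 0⌋
      rw [zero_add] at this
      simp only [mem_ofPred_eq, this]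
      linarith [Int.floor_le (t - H 0)]
    have hbdd : ∀ t, BddAbove (K '' {x | H x ≤ t}) := fun t => by
      refine ⟨K ((⌊t - H 0⌋ + 1 : ℤ) : ℝ), ?_⟩
      rintro _ ⟨x, hx, rfl⟩
      refine hK (le_of_not_gt fun hlt => ?_)
      have h1 := hHn 0 (⌊t - H 0⌋ + 1)
      rw [zero_add] at h1
      have h2 := hmono hlt.le
      have h3 := Int.lt_floor_add_one (t - H 0)
      simp only [mem_ofPred_eq] at hx
      push_cast at h1 h2
      linarith
    have hshift : ∀ (c : ℝ) (s : Set ℝ), s.Nonempty → BddAbove s →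
        sSup ((fun x => x + c) '' s) = sSup s + c := fun c s hs hb =>
      ((OrderIso.addRight c).map_csSup' hs hb).symm
    have htrans : ∀ (t : ℝ) (n : ℤ), sSup (K '' {x | H x ≤ t + n}) =
        sSup (K '' {x | H x ≤ t}) + n := fun t n => by
      rw [← hshift _ _ (hne t) (hbdd t)]
      congr 1
      ext y
      constructor
      · rintro ⟨x, hx, rfl⟩
        refine ⟨_, ⟨x - n, ?_, rfl⟩, ?_⟩
        · have := hHn (x - n) n
          rw [sub_add_cancel] at this
          simp only [mem_ofPred_eq] at hx ⊢
          linarith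
        · simp only [← hKn, sub_add_cancel]
      · rintro ⟨_, ⟨x, hx, rfl⟩, rfl⟩
        refine ⟨x + n, ?_, hKn x n⟩
        simp only [mem_ofPred_eq] at hx ⊢
        rw [hHn]
        linarith
    refine ⟨fun t => sSup (K '' {x | H x ≤ t}), fun t u htu => ?_, fun t => ?_,
      fun γ G hG t u => ?_⟩
    · exact csSup_le_csSup (hbdd u) (hne t) (image_mono fun x hx => le_trans hx htu)
    · simpa using htrans t 1
    · obtain ⟨F₀, hF₀⟩ := hρ.1 γ
      obtain ⟨n, hn⟩ := hconj γ F₀ G hF₀ hG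
      obtain ⟨F, hF, hFG⟩ : ∃ F, IsCircleLift (ρ γ) F ∧ ∀ x, H (F x) = G (H x) :=
        ⟨_, hF₀.add_int (-n), fun x => by rw [hHn, hn]; push_cast; ring⟩
      have key : ∀ t, sSup (K '' {x | H x ≤ G t}) =
          sSup (K '' {x | H x ≤ t}) + (K (F 0) - K 0) := fun t => by
        rw [← hshift _ _ (hne t) (hbdd t)]
        congr 1
        ext y
        constructor
        · rintro ⟨x, hx, rfl⟩
          obtain ⟨x, rfl⟩ := hF.surjective x
          refine ⟨_, ⟨x, ?_, rfl⟩, ?_⟩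
          · simp only [mem_ofPred_eq, hFG] at hx
            exact hG.strictMono.le_iff_le.1 hx
          · have := hKF γ F hF 0 x
            simp only
            linarith
        · rintro ⟨_, ⟨x, hx, rfl⟩, rfl⟩
          refine ⟨F x, ?_, ?_⟩
          · simp only [mem_ofPred_eq, hFG]
            exact hG.strictMono.monotone hx
          · have := hKF γ F hF 0 x
            simp only
            linarith
      simp only [key]
      ring
  · rintro ⟨K, hK, hK1, hKF⟩
    refine ⟨K ∘ H, hK.comp hmono, fun x => by simp [hone, hK1], fun γ F hF x y => ?_⟩
    obtain ⟨G, hG⟩ := hρ₁.1 γ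
    obtain ⟨n, hn⟩ := hconj γ F G hF hG
    have := hKF γ G hG (H x) (H y)
    simp only [Function.comp_apply, hn, map_add_int_of_map_add_one hK1]
    linarith

theorem S1.dist_coe_le (x y : ℝ) : dist (x : S1) (y : S1) ≤ |x - y| := by
  rw [dist_eq_norm, ← AddCircle.coe_sub, UnitAddCircle.norm_eq]
  simpa using round_le (x - y) 0

theorem uniformContinuous_of_map_add_one {U : ℝ → ℝ} (hU : Continuous U)
    (h : ∀ x, U (x + 1) = U x + 1) : UniformContinuous U := by
  have hp : Function.Periodic (fun x => U x - x) 1 := fun x => by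
    show U (x + 1) - (x + 1) = U x - x
    rw [h]; ring
  have hlift : Continuous (hp.lift : S1 → ℝ) :=
    continuous_coinduced_dom.2 (hU.sub continuous_id)
  have hcoe : UniformContinuous fun x : ℝ => (x : S1) :=
    Metric.uniformContinuous_iff.2 fun ε hε => ⟨ε, hε, fun {x y} hxy =>
      (S1.dist_coe_le x y).trans_lt hxy⟩
  have := ((CompactSpace.uniformContinuous_of_continuous hlift).comp hcoe).add
    uniformContinuous_id
  have e : U = (fun x => (hp.lift ∘ fun x : ℝ => (x : S1)) x + id x) := by
    funext x
    simp [Function.Periodic.lift_coe]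
  rw [e]
  exact this

theorem surjective_of_map_add_one {U : ℝ → ℝ} (hU : Continuous U)
    (h : ∀ x, U (x + 1) = U x + 1) : Function.Surjective U := by
  intro t
  have hn := map_add_int_of_map_add_one h 0
  simp only [zero_add] at hn
  have h1 : U ((⌊t - U 0⌋ : ℤ) : ℝ) ≤ t := by
    rw [hn]; linarith [Int.floor_le (t - U 0)]
  have h2 : t ≤ U ((⌈t - U 0⌉ : ℤ) : ℝ) := by
    rw [hn]; linarith [Int.le_ceil (t - U 0)]
  exact mem_range_of_exists_le_of_exists_ge hU ⟨_, h1⟩ ⟨_, h2⟩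

theorem S1.exists_abs_sub_eq_dist (u v : S1) :
    ∃ x y : ℝ, (x : S1) = u ∧ (y : S1) = v ∧ |x - y| = dist u v := by
  obtain ⟨x, rfl⟩ := QuotientAddGroup.mk_surjective u
  obtain ⟨y, rfl⟩ := QuotientAddGroup.mk_surjective v
  refine ⟨x - round (x - y), y, ?_, rfl, ?_⟩
  · exact S1.coe_eq_coe_iff.2 ⟨-round (x - y), by push_cast; ring⟩
  · have : dist (x : S1) (y : S1) = |x - y - round (x - y)| := by
      rw [dist_eq_norm, ← AddCircle.coe_sub, UnitAddCircle.norm_eq]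
    refine Eq.trans ?_ this.symm
    congr 1
    ring

section

variable {Γ : Type*} [Group Γ] {ρ : Γ → S1 → S1}

theorem MinimalAction.strictMono_of_rotationFactor (hρ : IsCircleAction Γ ρ)
    (hmin : MinimalAction ρ) {K : ℝ → ℝ} (hK : Monotone K) (hK1 : ∀ x, K (x + 1) = K x + 1)
    (hKF : ∀ γ F, IsCircleLift (ρ γ) F → ∀ x y, K (F y) - K (F x) = K y - K x) :
    StrictMono K := by
  intro a b hab
  refine lt_of_le_of_ne (hK hab.le) fun heq => ?_
  have hconst : ∀ u ∈ Ioo a b, K u = K a := fun u hu =>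
    le_antisymm (heq ▸ hK hu.2.le) (hK hu.1.le)
  have hloc : IsLocallyConstant K := by
    rw [IsLocallyConstant.iff_eventually_eq]
    intro t
    obtain ⟨γ, F, hF, ht⟩ := hmin.exists_lift_mem hρ t isOpen_Ioo (nonempty_Ioo.2 hab)
    filter_upwards [hF.continuous.continuousAt.preimage_mem_nhds (isOpen_Ioo.mem_nhds ht)]
      with u hu
    have := hKF γ F hF t u
    rw [hconst _ hu, hconst _ ht] at this
    linarith
  have h1 := hK1 0
  rw [hloc.apply_eq_of_preconnectedSpace (0 + 1) 0] at h1
  linarith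

theorem MinimalAction.continuous_of_rotationFactor (hρ : IsCircleAction Γ ρ)
    (hmin : MinimalAction ρ) {K : ℝ → ℝ} (hK : Monotone K)
    (hKF : ∀ γ F, IsCircleLift (ρ γ) F → ∀ x y, K (F y) - K (F x) = K y - K x) :
    Continuous K := by
  obtain ⟨c, hc⟩ : ∃ c, ContinuousAt K c := by
    by_contra! hcon
    have := hK.countable_not_continuousAt
    simp only [hcon, not_false_eq_true, ofPred_true] at this
    exact not_countable_univ this
  rw [continuous_iff_continuousAt]
  intro t
  rw [Metric.continuousAt_iff']
  intro ε hε
  have hV := Metric.continuousAt_iff'.1 hc (ε / 2) (half_pos hε)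
  obtain ⟨V, hVs, hVo, hcV⟩ := eventually_nhds_iff.1 hV
  obtain ⟨γ, F, hF, ht⟩ := hmin.exists_lift_mem hρ t hVo ⟨c, hcV⟩
  filter_upwards [hF.continuous.continuousAt.preimage_mem_nhds (hVo.mem_nhds ht)] with u hu
  rw [Real.dist_eq, ← hKF γ F hF t u, ← Real.dist_eq]
  have h1 := hVs _ hu
  have h2 := hVs _ ht
  have h3 := dist_triangle_right (K (F u)) (K (F t)) (K c)
  linarith

theorem MinimalAction.equicontinuous_of_hasRotationFactor (hρ : IsCircleAction Γ ρ)
    (hmin : MinimalAction ρ) (h : HasRotationFactor ρ) : Equicontinuous fun γ => ρ γ := by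
  obtain ⟨K, hK, hK1, hKF⟩ := h
  have hcont := hmin.continuous_of_rotationFactor hρ hK hKF
  have hstrict := hmin.strictMono_of_rotationFactor hρ hK hK1 hKF
  have hsurj := surjective_of_map_add_one hcont hK1
  set e : ℝ ≃o ℝ := hstrict.orderIsoOfSurjective K hsurj with he
  have hunif : UniformContinuous e.symm :=
    uniformContinuous_of_map_add_one e.symm.continuous fun x => by
      rw [e.symm_apply_eq]
      show x + 1 = K (e.symm x + 1)
      rw [hK1]
      show x + 1 = e (e.symm x) + 1
      rw [e.apply_symm_apply]
  have hKunif := uniformContinuous_of_map_add_one hcont hK1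
  refine UniformEquicontinuous.equicontinuous ?_
  rw [Metric.uniformEquicontinuous_iff]
  intro ε hε
  obtain ⟨η, hη, hη'⟩ := Metric.uniformContinuous_iff.1 hunif ε hε
  obtain ⟨δ, hδ, hδ'⟩ := Metric.uniformContinuous_iff.1 hKunif η hη
  refine ⟨δ, hδ, fun u v huv γ => ?_⟩
  obtain ⟨x, y, rfl, rfl, hxy⟩ := S1.exists_abs_sub_eq_dist u v
  obtain ⟨F, hF⟩ := hρ.1 γ
  have h1 : dist (K (F x)) (K (F y)) < η := by
    rw [Real.dist_eq, hKF γ F hF y x, ← Real.dist_eq]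
    exact hδ' (by rw [Real.dist_eq, hxy]; exact huv)
  have h2 := hη' h1
  have h3 : ∀ z, e.symm (K z) = z := fun z => e.symm_apply_apply z
  rw [h3, h3, Real.dist_eq] at h2
  show dist (ρ γ x) (ρ γ y) < ε
  rw [hF.map_coe, hF.map_coe]
  exact (S1.dist_coe_le _ _).trans_lt h2

end

/-- There is an `R`-chain with `n` steps from `x` to `y`. -/
def HasChain (R : ℝ → ℝ → Prop) : ℕ → ℝ → ℝ → Prop
  | 0, x, y => x = y
  | n + 1, x, y => ∃ z, R x z ∧ HasChain R n z y

namespace HasChain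

variable {R : ℝ → ℝ → Prop}

theorem trans {a b : ℕ} {x y z : ℝ} (h₁ : HasChain R a x y) (h₂ : HasChain R b y z) :
    HasChain R (a + b) x z := by
  induction a generalizing x with
  | zero => obtain rfl : x = y := h₁; rwa [zero_add]
  | succ a ih =>
    obtain ⟨w, hw, h⟩ := h₁
    rw [Nat.succ_add]
    exact ⟨w, hw, ih h⟩

theorem map {f : ℝ → ℝ} (hf : ∀ x y, R x y → R (f x) (f y)) {n : ℕ} {x y : ℝ}
    (h : HasChain R n x y) : HasChain R n (f x) (f y) := by
  induction n generalizing x with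
  | zero => exact congrArg f h
  | succ n ih =>
    obtain ⟨w, hw, h⟩ := h
    exact ⟨f w, hf _ _ hw, ih h⟩

theorem le (hR : ∀ x y, R x y → x ≤ y) {n : ℕ} {x y : ℝ} (h : HasChain R n x y) : x ≤ y := by
  induction n generalizing x with
  | zero => exact (show x = y from h).le
  | succ n ih =>
    obtain ⟨w, hw, h⟩ := h
    exact (hR _ _ hw).trans (ih h)

theorem sub_le {ε : ℝ} (hR : ∀ x y, R x y → y - x ≤ ε) {n : ℕ} {x y : ℝ}
    (h : HasChain R n x y) : y - x ≤ n * ε := by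
  induction n generalizing x with
  | zero => obtain rfl : x = y := h; simp
  | succ n ih =>
    obtain ⟨w, hw, h⟩ := h
    have h1 := ih h
    have h2 := hR _ _ hw
    push_cast
    linarith

theorem split
    (hmono : ∀ x x' y' y, R x y → x ≤ x' → x' ≤ y' → y' ≤ y → R x' y') {n : ℕ} {x y z : ℝ}
    (h : HasChain R n x z) (hxy : x ≤ y) (hyz : y ≤ z) :
    ∃ a b, a + b ≤ n + 1 ∧ HasChain R a x y ∧ HasChain R b y z := by
  induction n generalizing x with
  | zero =>
    obtain rfl : x = z := h
    exact ⟨0, 0, by simp, le_antisymm hxy hyz, le_antisymm hyz hxy⟩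
  | succ n ih =>
    obtain ⟨w, hw, h⟩ := h
    rcases le_total y w with hyw | hwy
    · exact ⟨1, n + 1, by lia, ⟨y, hmono _ _ _ _ hw le_rfl hxy hyw, rfl⟩,
        w, hmono _ _ _ _ hw hxy hyw le_rfl, h⟩
    · obtain ⟨a, b, hab, ha, hb⟩ := ih h hwy
      exact ⟨a + 1, b, by lia, ⟨w, hw, ha⟩, hb⟩

theorem of_le_add {δ : ℝ} (hδ : 0 < δ) (hR : ∀ x y, x ≤ y → y ≤ x + δ → R x y) (n : ℕ)
    {x y : ℝ} (hxy : x ≤ y) (hy : y ≤ x + n * δ) : HasChain R n x y := by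
  induction n generalizing x with
  | zero => exact le_antisymm hxy (by simpa using hy)
  | succ n ih =>
    push_cast at hy
    refine ⟨min y (x + δ), hR _ _ (le_min hxy (by linarith)) (min_le_right _ _),
      ih (min_le_left _ _) ?_⟩
    rcases le_total y (x + δ) with h | h
    · rw [min_eq_left h]
      nlinarith [n.cast_nonneg (α := ℝ)]
    · rw [min_eq_right h]
      linarith

end HasChain

section

variable {Γ : Type*} {ρ : Γ → S1 → S1}

/-- The interval from `x` to `y` and all its translates have length at most `ε`. -/
def IsSmallStep (ρ : Γ → S1 → S1) (ε x y : ℝ) : Prop :=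
  x ≤ y ∧ ∀ γ F, IsCircleLift (ρ γ) F → F y - F x ≤ ε

/-- The least number of `ε`-small steps from `x` to `y` (zero if `y < x`). -/
def stepCount (ρ : Γ → S1 → S1) (ε x y : ℝ) : ℕ :=
  sInf {n | HasChain (IsSmallStep ρ ε) n x y}

theorem exists_isSmallStep_of_equicontinuous (hρ : Equicontinuous fun γ => ρ γ) {ε : ℝ}
    (hε : 0 < ε) : ∃ δ > 0, ∀ x y, x ≤ y → y ≤ x + δ → IsSmallStep ρ ε x y := by
  have hu := CompactSpace.uniformEquicontinuous_of_equicontinuous hρ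
  obtain ⟨δ, hδ, h⟩ := Metric.uniformEquicontinuous_iff.1 hu (min ε (1 / 2)) (by positivity)
  refine ⟨δ / 2, half_pos hδ, fun x y hxy hy => ⟨hxy, fun γ F hF => ?_⟩⟩
  by_contra! hlt
  obtain ⟨w, hw⟩ := hF.surjective (F x + min ε (1 / 2))
  have hm : 0 < min ε (1 / 2) := by positivity
  have hxw : x < w := hF.strictMono.lt_iff_lt.1 (by linarith)
  have hwy : w < y := hF.strictMono.lt_iff_lt.1 (by linarith [min_le_left ε (1 / 2)])
  have h1 : dist (ρ γ w) (ρ γ x) < min ε (1 / 2) := by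
    refine h w x ((S1.dist_coe_le w x).trans_lt ?_) γ
    rw [abs_of_pos (by linarith)]
    linarith
  rw [hF.map_coe, hF.map_coe, hw, dist_eq_norm, ← AddCircle.coe_sub, add_sub_cancel_left,
    (AddCircle.norm_coe_eq_abs_iff 1 one_ne_zero).2, abs_of_pos hm] at h1
  · exact lt_irrefl _ h1
  · rw [abs_of_pos hm, abs_one]
    exact min_le_right _ _

theorem IsSmallStep.mono {ε x x' y' y : ℝ} (h : IsSmallStep ρ ε x y) (hx : x ≤ x')
    (hxy : x' ≤ y') (hy : y' ≤ y) : IsSmallStep ρ ε x' y' :=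
  ⟨hxy, fun γ F hF => by
    have h1 := h.2 γ F hF
    have h2 := hF.strictMono.monotone hx
    have h3 := hF.strictMono.monotone hy
    linarith⟩

theorem stepCount_of_lt {ε x y : ℝ} (h : y < x) : stepCount ρ ε x y = 0 := by
  have : {n | HasChain (IsSmallStep ρ ε) n x y} = ∅ :=
    eq_empty_of_forall_notMem fun n hn => h.not_ge (HasChain.le (fun _ _ h => h.1) hn)
  rw [stepCount, this, Nat.sInf_empty]

theorem hasChain_stepCount (hρ : Equicontinuous fun γ => ρ γ) {ε x y : ℝ} (hε : 0 < ε)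
    (h : x ≤ y) : HasChain (IsSmallStep ρ ε) (stepCount ρ ε x y) x y := by
  obtain ⟨δ, hδ, hstep⟩ := exists_isSmallStep_of_equicontinuous hρ hε
  refine Nat.sInf_mem (s := {n | HasChain (IsSmallStep ρ ε) n x y})
    ⟨⌈(y - x) / δ⌉₊, HasChain.of_le_add hδ hstep _ h ?_⟩
  have := (div_le_iff₀ hδ).1 (Nat.le_ceil ((y - x) / δ))
  linarith

theorem stepCount_le_add (hρ : Equicontinuous fun γ => ρ γ) {ε x y z : ℝ} (hε : 0 < ε)
    (hxy : x ≤ y) (hyz : y ≤ z) :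
    stepCount ρ ε x z ≤ stepCount ρ ε x y + stepCount ρ ε y z :=
  Nat.sInf_le ((hasChain_stepCount hρ hε hxy).trans (hasChain_stepCount hρ hε hyz))

theorem stepCount_add_le (hρ : Equicontinuous fun γ => ρ γ) {ε x y z : ℝ} (hε : 0 < ε)
    (hxy : x ≤ y) (hyz : y ≤ z) :
    stepCount ρ ε x y + stepCount ρ ε y z ≤ stepCount ρ ε x z + 1 := by
  obtain ⟨a, b, hab, ha, hb⟩ := (hasChain_stepCount hρ hε (hxy.trans hyz)).split
    (fun _ _ _ _ h h1 h2 h3 => h.mono h1 h2 h3) hxy hyz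
  exact (add_le_add (Nat.sInf_le ha) (Nat.sInf_le hb)).trans hab

variable [Group Γ]

theorem IsSmallStep.map (hρ : IsCircleAction Γ ρ) {ε x y : ℝ} (h : IsSmallStep ρ ε x y)
    {γ : Γ} {F : ℝ → ℝ} (hF : IsCircleLift (ρ γ) F) : IsSmallStep ρ ε (F x) (F y) :=
  ⟨hF.strictMono.monotone h.1, fun _ _ hG => h.2 _ _ (hρ.lift_comp hG hF)⟩

theorem stepCount_map (hρ : IsCircleAction Γ ρ) (ε x y : ℝ) {γ : Γ} {F : ℝ → ℝ}
    (hF : IsCircleLift (ρ γ) F) : stepCount ρ ε (F x) (F y) = stepCount ρ ε x y := by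
  obtain ⟨G, hG, -, hGF⟩ := hρ.exists_lift_inv hF
  have : {n | HasChain (IsSmallStep ρ ε) n (F x) (F y)} =
      {n | HasChain (IsSmallStep ρ ε) n x y} := by
    ext n
    refine ⟨fun h => ?_, fun h => h.map fun x y hxy => hxy.map hρ hF⟩
    have := HasChain.map (f := G) (fun x y hxy => hxy.map hρ hG) h
    rwa [hGF, hGF] at this
  rw [stepCount, stepCount, this]

theorem stepCount_int (hρ : IsCircleAction Γ ρ) (ε : ℝ) (x y : ℝ) (n : ℤ) :
    stepCount ρ ε (x + n) (y + n) = stepCount ρ ε x y :=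
  stepCount_map hρ ε x y (hρ.lift_add_int n)

theorem stepCount_int_add_nat_le (hρ : IsCircleAction Γ ρ) (he : Equicontinuous fun γ => ρ γ)
    {ε : ℝ} (hε : 0 < ε) (x : ℤ) (j : ℕ) :
    stepCount ρ ε x (x + j) ≤ j * stepCount ρ ε 0 1 := by
  induction j with
  | zero =>
    simp only [Nat.cast_zero, add_zero, zero_mul]
    exact Nat.sInf_le (show HasChain (IsSmallStep ρ ε) 0 (x : ℝ) x from rfl)
  | succ j ih =>
    have h1 := stepCount_le_add he hε (x := (x : ℝ)) (y := x + j) (z := x + (j + 1 : ℕ))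
      (by simp) (by push_cast; linarith)
    have h2 := stepCount_int hρ ε 0 1 (x + j)
    have e1 : (0 : ℝ) + ((x + j : ℤ) : ℝ) = x + j := by push_cast; ring
    have e2 : (1 : ℝ) + ((x + j : ℤ) : ℝ) = x + (j + 1 : ℕ) := by push_cast; ring
    rw [e1, e2] at h2
    rw [h2] at h1
    rw [Nat.succ_mul]
    lia

theorem le_stepCount_mul (hρ : IsCircleAction Γ ρ) (he : Equicontinuous fun γ => ρ γ) {ε : ℝ}
    (hε : 0 < ε) : 1 ≤ stepCount ρ ε 0 1 * ε := by
  have := (hasChain_stepCount he hε zero_le_one).sub_le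
    (fun x y h => h.2 1 id hρ.lift_id)
  simpa using this

/-- Bounded real sequences depending on parameters have simultaneous ultralimits. -/
theorem exists_ultralimit {ι : Type*} (u : ℕ → ι → ℝ)
    (hu : ∀ i, ∃ a b, ∀ k, u k i ∈ Icc a b) :
    ∃ v : ι → ℝ, ∀ i, Tendsto (fun k => u k i) (hyperfilter ℕ : Filter ℕ) (nhds (v i)) := by
  have : ∀ i, ∃ l, Tendsto (fun k => u k i) (hyperfilter ℕ : Filter ℕ) (nhds l) := fun i => by
    obtain ⟨a, b, h⟩ := hu i
    obtain ⟨l, -, hl⟩ := isCompact_Icc.ultrafilter_le_nhds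
      ((hyperfilter ℕ).map fun k => u k i)
      (by
        rw [Ultrafilter.coe_map, le_principal_iff, mem_map]
        exact univ_mem' h)
    exact ⟨l, hl⟩
  exact ⟨_, fun i => (this i).choose_spec⟩

/-- An invariant additive interval function yields a semi-conjugacy to rotations. -/
theorem hasRotationFactor_of_additive (hρ : IsCircleAction Γ ρ) {m : ℝ → ℝ → ℝ}
    (hnonneg : ∀ x y, 0 ≤ m x y) (hlt : ∀ x y, y < x → m x y = 0)
    (hadd : ∀ x y z, x ≤ y → y ≤ z → m x y + m y z = m x z) (hone : m 0 1 = 1)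
    (hmap : ∀ γ F, IsCircleLift (ρ γ) F → ∀ x y, m (F x) (F y) = m x y) :
    HasRotationFactor ρ := by
  have hself : ∀ x, m x x = 0 := fun x => by
    have := hadd x x x le_rfl le_rfl
    linarith
  have hsub : ∀ x y, (m 0 y - m y 0) - (m 0 x - m x 0) = m x y - m y x := by
    have key : ∀ x y, x ≤ y → (m 0 y - m y 0) - (m 0 x - m x 0) = m x y - m y x := by
      intro x y hxy
      have hyx : m y x = 0 := by
        rcases hxy.lt_or_eq with h | rfl
        exacts [hlt _ _ h, hself _]
      have hz : ∀ a b, b ≤ a → m a b = 0 := fun a b hab => by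
        rcases hab.lt_or_eq with h | rfl
        exacts [hlt _ _ h, hself _]
      rcases le_total 0 x with h0 | h0
      · linarith [hadd 0 x y h0 hxy, hz y 0 (h0.trans hxy), hz x 0 h0]
      · rcases le_total 0 y with h1 | h1
        · linarith [hadd x 0 y h0 h1, hz y 0 h1, hz 0 x h0]
        · linarith [hadd x y 0 hxy h1, hz 0 y h1, hz 0 x h0]
    intro x y
    rcases le_total x y with h | h
    · exact key x y h
    · linarith [key y x h]
  have hint : ∀ x y (n : ℤ), m (x + n) (y + n) = m x y := fun x y n =>
    hmap 1 _ (hρ.lift_add_int n) x y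
  refine ⟨fun x => m 0 x - m x 0, fun x y hxy => ?_, fun x => ?_, fun γ F hF x y => ?_⟩
  · have h1 := hsub x y
    have h2 : m y x = 0 := by
      rcases hxy.lt_or_eq with h | rfl
      exacts [hlt _ _ h, hself _]
    have h3 := hnonneg x y
    simp only
    linarith
  · have h1 := hsub x (x + 1)
    have h2 := hlt (x + 1) x (by linarith)
    have h3 := hadd ⌊x⌋ x (⌊x⌋ + 1) (Int.floor_le x) (Int.lt_floor_add_one x).le
    have h4 := hadd x (⌊x⌋ + 1) (x + 1) (Int.lt_floor_add_one x).le
      (by linarith [Int.floor_le x])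
    have h5 := hint 0 1 ⌊x⌋
    have h6 := hint ⌊x⌋ x 1
    rw [zero_add, add_comm (1 : ℝ)] at h5
    rw [Int.cast_one] at h6
    simp only
    linarith
  · simp only [hsub, hmap γ F hF]

theorem hasRotationFactor_of_equicontinuous (hρ : IsCircleAction Γ ρ)
    (he : Equicontinuous fun γ => ρ γ) : HasRotationFactor ρ := by
  have hε : ∀ k : ℕ, (0 : ℝ) < 1 / (k + 1) := fun k => by positivity
  have hq : ∀ k : ℕ, (k + 1 : ℝ) ≤ stepCount ρ (1 / (k + 1)) 0 1 := fun k => by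
    have := le_stepCount_mul hρ he (hε k)
    rwa [mul_one_div, le_div_iff₀ (by positivity), one_mul] at this
  have hq0 : ∀ k : ℕ, (0 : ℝ) < stepCount ρ (1 / (k + 1)) 0 1 := fun k =>
    lt_of_lt_of_le (by positivity) (hq k)
  obtain ⟨m, hm⟩ := exists_ultralimit (fun (k : ℕ) (p : ℝ × ℝ) =>
      (stepCount ρ (1 / (k + 1)) p.1 p.2 : ℝ) / stepCount ρ (1 / (k + 1)) 0 1) <| by
    rintro ⟨x, y⟩
    simp only
    refine ⟨0, ⌈y - ⌊x⌋⌉₊ + 2, fun k => ⟨by positivity, ?_⟩⟩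
    rw [div_le_iff₀ (hq0 k)]
    rcases lt_or_ge y x with hyx | hxy
    · rw [stepCount_of_lt hyx]
      push_cast
      positivity
    · have h1 := stepCount_add_le he (hε k) (Int.floor_le x) hxy
      have hy : y ≤ (⌊x⌋ : ℝ) + ⌈y - ⌊x⌋⌉₊ := by linarith [Nat.le_ceil (y - ⌊x⌋)]
      have h2 := stepCount_add_le he (hε k) ((Int.floor_le x).trans hxy) hy
      have h3 := stepCount_int_add_nat_le hρ he (hε k) ⌊x⌋ ⌈y - ⌊x⌋⌉₊
      have h4 : stepCount ρ (1 / (k + 1)) x y ≤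
          ⌈y - ⌊x⌋⌉₊ * stepCount ρ (1 / (k + 1)) 0 1 + 2 := by lia
      have h5 : (stepCount ρ (1 / (k + 1)) x y : ℝ) ≤
          ⌈y - ⌊x⌋⌉₊ * stepCount ρ (1 / (k + 1)) 0 1 + 2 := by exact_mod_cast h4
      have h6 := hq k
      have h7 : (0 : ℝ) ≤ k := k.cast_nonneg
      linarith
  have hinv : Tendsto (fun k : ℕ => 1 / ((k : ℝ) + 1)) (hyperfilter ℕ : Filter ℕ) (nhds 0) :=
    tendsto_one_div_add_atTop_nhds_zero_nat.mono_left Nat.hyperfilter_le_atTop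
  refine hasRotationFactor_of_additive hρ (m := fun x y => m (x, y)) (fun x y => ?_)
    (fun x y hyx => ?_) (fun x y z hxy hyz => ?_) ?_ (fun γ F hF x y => ?_)
  · exact ge_of_tendsto' (hm (x, y)) fun k => by positivity
  · refine tendsto_nhds_unique (hm (x, y)) ?_
    simp only [stepCount_of_lt hyx, Nat.cast_zero, zero_div]
    exact tendsto_const_nhds
  · have h1 := (hm (x, y)).add (hm (y, z))
    have h2 := h1.sub (hm (x, z))
    have h3 : Tendsto (fun k : ℕ =>
        (stepCount ρ (1 / (k + 1)) x y : ℝ) / stepCount ρ (1 / (k + 1)) 0 1 +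
        (stepCount ρ (1 / (k + 1)) y z : ℝ) / stepCount ρ (1 / (k + 1)) 0 1 -
        (stepCount ρ (1 / (k + 1)) x z : ℝ) / stepCount ρ (1 / (k + 1)) 0 1)
        (hyperfilter ℕ : Filter ℕ) (nhds 0) := by
      refine squeeze_zero (fun k => ?_) (fun k => ?_) hinv
      · rw [← add_div, ← sub_div]
        refine div_nonneg ?_ (hq0 k).le
        have := stepCount_le_add he (hε k) hxy hyz
        rw [sub_nonneg]
        exact_mod_cast this
      · rw [← add_div, ← sub_div]
        have h4 : (stepCount ρ (1 / (k + 1)) x y + stepCount ρ (1 / (k + 1)) y z : ℝ) ≤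
            stepCount ρ (1 / (k + 1)) x z + 1 := by
          exact_mod_cast stepCount_add_le he (hε k) hxy hyz
        exact div_le_div₀ zero_le_one (by linarith) (by positivity) (hq k)
    linarith [tendsto_nhds_unique h2 h3]
  · refine tendsto_nhds_unique (hm (0, 1)) ?_
    simp only [div_self (hq0 _).ne']
    exact tendsto_const_nhds
  · refine tendsto_nhds_unique (hm (F x, F y)) ?_
    simp only [stepCount_map hρ _ _ _ hF]
    exact hm (x, y)

end

/-- Normalized primitive of a measure on the line invariant under the unit translation. -/
theorem exists_primitive_of_periodic (ν : Measure ℝ) [IsLocallyFiniteMeasure ν]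
    (hper : ∀ x y, ν (Ioc (x + 1) (y + 1)) = ν (Ioc x y)) (hne : ν (Ioc 0 1) ≠ 0) :
    ∃ H : ℝ → ℝ, Monotone H ∧ (∀ x, H (x + 1) = H x + 1) ∧
      (∃ c > 0, ∀ x y, x ≤ y → H y - H x = c * ν.real (Ioc x y)) ∧
      (NullSingletonClass ν → Continuous H) := by
  have hint : ∀ a b, IntervalIntegrable (fun _ => (1 : ℝ)) ν a b := fun a b =>
    intervalIntegrable_const
  have hpos : 0 < ν.real (Ioc 0 1) := by
    rw [measureReal_def]
    exact ENNReal.toReal_pos hne measure_Ioc_lt_top.ne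
  set c := (ν.real (Ioc 0 1))⁻¹ with hc
  have hc0 : 0 < c := inv_pos.2 hpos
  have hdiff : ∀ x y, x ≤ y → c * (∫ _ in (0 : ℝ)..y, (1 : ℝ) ∂ν) -
      c * (∫ _ in (0 : ℝ)..x, (1 : ℝ) ∂ν) = c * ν.real (Ioc x y) := fun x y hxy => by
    rw [← mul_sub, intervalIntegral.integral_interval_sub_left (hint 0 y) (hint 0 x),
      intervalIntegral.integral_of_le hxy]
    simp
  have hmono : Monotone fun x => c * (∫ _ in (0 : ℝ)..x, (1 : ℝ) ∂ν) := fun x y hxy => by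
    have h1 := hdiff x y hxy
    have h2 : 0 ≤ c * ν.real (Ioc x y) := by positivity
    simp only
    linarith
  have hper1 : ∀ x y, ν.real (Ioc (x + 1) (y + 1)) = ν.real (Ioc x y) := fun x y => by
    rw [measureReal_def, measureReal_def, hper]
  have hone : ∀ x, ν.real (Ioc x (x + 1)) = ν.real (Ioc 0 1) := by
    have hadd : ∀ a b d, a ≤ b → b ≤ d →
        ν.real (Ioc a b) + ν.real (Ioc b d) = ν.real (Ioc a d) := fun a b d hab hbd => by
      have h1 := hdiff a b hab
      have h2 := hdiff b d hbd
      have h3 := hdiff a d (hab.trans hbd)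
      refine mul_left_cancel₀ hc0.ne' ?_
      linarith
    have hper2 : Function.Periodic (fun x => ν.real (Ioc x (x + 1))) 1 := fun x => hper1 x _
    intro x
    have h0 : ν.real (Ioc (Int.fract x) (Int.fract x + 1)) = ν.real (Ioc x (x + 1)) := by
      have := hper2.sub_int_mul_eq (x := x) ⌊x⌋
      simpa [Int.self_sub_floor] using this
    rw [← h0, ← hadd (Int.fract x) 1 (Int.fract x + 1) (Int.fract_lt_one x).le
      (by linarith [Int.fract_nonneg x]), ← hadd 0 (Int.fract x) 1 (Int.fract_nonneg x)
      (Int.fract_lt_one x).le, ← hper1 0, zero_add]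
    ring
  refine ⟨_, hmono, fun x => ?_, ⟨c, hc0, hdiff⟩, fun h => ?_⟩
  · have h1 := hdiff x (x + 1) (by linarith)
    rw [hone, hc, inv_mul_cancel₀ hpos.ne'] at h1
    linarith
  · have := h
    exact continuous_const.mul (intervalIntegral.continuous_primitive hint 0)

/-- An uncountable Borel set of reals carries an atomless probability measure. -/
theorem exists_nullSingletonClass_of_not_countable {S : Set ℝ} (hS : MeasurableSet S)
    (hunc : ¬ S.Countable) :
    ∃ μ : Measure ℝ, IsFiniteMeasure μ ∧ NullSingletonClass μ ∧ μ Sᶜ = 0 ∧ μ S ≠ 0 := by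
  have : StandardBorelSpace S := hS.standardBorel
  have e : ℝ ≃ᵐ S := PolishSpace.measurableEquivOfNotCountable
    (fun h => not_countable_univ (α := ℝ) (countable_univ_iff.2 h))
    (fun h => hunc (countable_coe_iff.1 h))
  have hmeas : Measurable fun x => (e x : ℝ) := measurable_subtype_coe.comp e.measurable
  set lam : Measure ℝ := volume.restrict (Icc 0 1)
  refine ⟨lam.map fun x => (e x : ℝ), inferInstance, ⟨fun x => ?_⟩, ?_, ?_⟩
  · rw [Measure.map_apply hmeas (measurableSet_singleton x)]
    refine Set.Subsingleton.measure_zero (fun a ha b hb => ?_) _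
    exact e.injective (Subtype.ext ((show (e a : ℝ) = x from ha).trans
      (show (e b : ℝ) = x from hb).symm))
  · rw [Measure.map_apply hmeas hS.compl]
    have : (fun x => (e x : ℝ)) ⁻¹' Sᶜ = ∅ :=
      eq_empty_of_forall_notMem fun x hx => hx (e x).2
    rw [this, measure_empty]
  · rw [Measure.map_apply hmeas hS]
    have : (fun x => (e x : ℝ)) ⁻¹' S = univ := eq_univ_of_forall fun x => (e x).2
    rw [this]
    simp [lam]

theorem Preperfect.not_countable_inter_Icc {M : Set ℝ} (hM : Preperfect M) (hc : IsClosed M)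
    {a b : ℝ} (hne : (Ioo a b ∩ M).Nonempty) : ¬ (M ∩ Icc a b).Countable := by
  have hp : Perfect (closure (Ioo a b ∩ M)) := (hM.open_inter isOpen_Ioo).perfect_closure
  obtain ⟨f, hf, -, hinj⟩ := hp.exists_nat_bool_injection hne.closure
  have hsub : range f ⊆ M ∩ Icc a b := hf.trans <|
    closure_minimal (fun x hx => ⟨hx.2, Ioo_subset_Icc_self hx.1⟩) (hc.inter isClosed_Icc)
  intro hcount
  have := (hcount.mono hsub).preimage_of_injOn (f := f) hinj.injOn
  rw [preimage_range] at this
  have hu : Uncountable (ℕ → Bool) := by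
    rw [← Cardinal.aleph0_lt_mk_iff]
    simpa using Cardinal.cantor Cardinal.aleph0
  exact not_countable_univ this

/-- A perfect set of reals is the support of a finite atomless measure. -/
theorem Preperfect.exists_nullSingletonClass {M : Set ℝ} (hM : Preperfect M) (hc : IsClosed M) :
    ∃ μ : Measure ℝ, IsFiniteMeasure μ ∧ NullSingletonClass μ ∧ μ Mᶜ = 0 ∧
      ∀ U, IsOpen U → (U ∩ M).Nonempty → μ U ≠ 0 := by
  have h : ∀ p : ℚ × ℚ, ∃ μ : Measure ℝ, IsFiniteMeasure μ ∧ NullSingletonClass μ ∧ μ Mᶜ = 0 ∧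
      ((Ioo (p.1 : ℝ) p.2 ∩ M).Nonempty → μ (Icc (p.1 : ℝ) p.2) ≠ 0) := by
    intro p
    by_cases hne : (Ioo (p.1 : ℝ) p.2 ∩ M).Nonempty
    · obtain ⟨μ, h1, h2, h3, h4⟩ := exists_nullSingletonClass_of_not_countable
        (hc.inter isClosed_Icc).measurableSet (hM.not_countable_inter_Icc hc hne)
      refine ⟨μ, h1, h2, measure_mono_null (compl_subset_compl.2 inter_subset_left) h3,
        fun _ h0 => h4 (measure_mono_null inter_subset_right h0)⟩
    · exact ⟨0, inferInstance, ⟨fun _ => rfl⟩, rfl, fun h => absurd h hne⟩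
  choose μ h1 h2 h3 h4 using h
  have hac := toFinite_absolutelyContinuous (Measure.sum μ)
  have hac' := absolutelyContinuous_toFinite (Measure.sum μ)
  refine ⟨(Measure.sum μ).toFinite, inferInstance, ⟨fun x => hac ?_⟩, hac ?_,
    fun U hU hne h0 => ?_⟩
  · rw [Measure.sum_apply _ (measurableSet_singleton x)]
    simp only [measure_singleton, tsum_zero]
  · rw [Measure.sum_apply _ hc.measurableSet.compl]
    simp [h3]
  · obtain ⟨x, hxU, hxM⟩ := hne
    obtain ⟨ε, hε, hball⟩ := Metric.isOpen_iff.1 hU x hxU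
    obtain ⟨a, ha, ha'⟩ := exists_rat_btwn (show x - ε < x by linarith)
    obtain ⟨b, hb, hb'⟩ := exists_rat_btwn (show x < x + ε by linarith)
    refine h4 (a, b) ⟨x, ⟨ha', hb⟩, hxM⟩ (measure_mono_null (t := U) ?_ ?_)
    · refine Subset.trans (fun y hy => ?_) hball
      rw [Metric.mem_ball, Real.dist_eq, abs_lt]
      constructor <;> linarith [hy.1, hy.2]
    · have := hac' h0
      rw [Measure.sum_apply _ hU.measurableSet] at this
      exact ENNReal.tsum_eq_zero.1 this (a, b)

/-- A periodic perfect set is the set of growth of a continuous monotone degree one map. -/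
theorem Preperfect.exists_continuous_monotone {M : Set ℝ} (hM : Preperfect M) (hc : IsClosed M)
    (hne : M.Nonempty) (hper : ∀ (x : ℝ) (n : ℤ), x ∈ M → x + n ∈ M) :
    ∃ H : ℝ → ℝ, Continuous H ∧ Monotone H ∧ (∀ x, H (x + 1) = H x + 1) ∧
      ∀ x y, x ≤ y → (H x = H y ↔ Ioo x y ∩ M = ∅) := by
  obtain ⟨μ, hfin, hna, hnull, hopen⟩ := hM.exists_nullSingletonClass hc
  set μ₀ := μ.restrict (Ioo (-1) 2)
  have hmeas : ∀ n : ℤ, Measurable fun x : ℝ => x + n := fun n => by fun_prop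
  set ν : Measure ℝ := Measure.sum fun n : ℤ => μ₀.map fun x => x + n with hν
  have happ : ∀ s, MeasurableSet s → ν s = ∑' n : ℤ, μ₀ ((fun x => x + (n : ℝ)) ⁻¹' s) :=
    fun s hs => by
      rw [hν, Measure.sum_apply _ hs]
      exact tsum_congr fun n => Measure.map_apply (hmeas n) hs
  have hfinite : ∀ a b, ν (Icc a b) < ⊤ := fun a b => by
    rw [happ _ measurableSet_Icc, tsum_eq_sum (s := Finset.Icc (⌊a⌋ - 2) (⌈b⌉ + 1))]
    · exact ENNReal.sum_lt_top.2 fun n _ => measure_lt_top _ _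
    · intro n hn
      rw [Measure.restrict_apply ((hmeas n) measurableSet_Icc)]
      convert measure_empty (μ := μ)
      refine eq_empty_of_forall_notMem ?_
      rintro x ⟨⟨h1, h2⟩, h3, h4⟩
      refine hn (Finset.mem_Icc.2 ⟨?_, ?_⟩)
      · have : (⌊a⌋ : ℝ) < n + 2 := by linarith [Int.floor_le a]
        have : ⌊a⌋ < n + 2 := by exact_mod_cast this
        lia
      · have : (n : ℝ) < ⌈b⌉ + 1 := by linarith [Int.le_ceil b]
        have : n < ⌈b⌉ + 1 := by exact_mod_cast this
        lia
  have : IsLocallyFiniteMeasure ν := ⟨fun x =>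
    ⟨Icc (x - 1) (x + 1), Icc_mem_nhds (by linarith) (by linarith), hfinite _ _⟩⟩
  have hνna : NullSingletonClass ν := ⟨fun x => by
    rw [happ _ (measurableSet_singleton x), ENNReal.tsum_eq_zero]
    intro n
    have : NullSingletonClass μ₀ := inferInstanceAs (NullSingletonClass (μ.restrict _))
    refine Set.Subsingleton.measure_zero (fun a ha b hb => ?_) _
    have h1 : a + n = x := ha
    have h2 : b + n = x := hb
    linarith⟩
  have hνper : ∀ x y, ν (Ioc (x + 1) (y + 1)) = ν (Ioc x y) := fun x y => by
    rw [happ _ measurableSet_Ioc, happ _ measurableSet_Ioc,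
      ← (Equiv.addRight (1 : ℤ)).tsum_eq]
    refine tsum_congr fun n => congrArg _ ?_
    ext z
    simp only [Equiv.coe_addRight, mem_preimage, mem_Ioc, Int.cast_add, Int.cast_one]
    constructor <;> rintro ⟨h1, h2⟩ <;> constructor <;> linarith
  have hνM : ν Mᶜ = 0 := by
    rw [happ _ hc.measurableSet.compl, ENNReal.tsum_eq_zero]
    intro n
    refine Measure.absolutelyContinuous_of_le Measure.restrict_le_self
      (measure_mono_null (fun x hx hxM => hx (hper x n hxM)) hnull)
  have hνopen : ∀ U, IsOpen U → (U ∩ M).Nonempty → ν U ≠ 0 := by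
    rintro U hU ⟨x, hxU, hxM⟩ h0
    rw [happ _ hU.measurableSet, ENNReal.tsum_eq_zero] at h0
    have h1 := h0 ⌊x⌋
    rw [Measure.restrict_apply (hmeas _ hU.measurableSet)] at h1
    refine hopen _ ((hU.preimage (continuous_add_const _)).inter isOpen_Ioo)
      ⟨x + (-⌊x⌋ : ℤ), ⟨?_, ?_⟩, hper x _ hxM⟩ h1
    · simpa using hxU
    · push_cast
      constructor <;> linarith [Int.floor_le x, Int.lt_floor_add_one x]
  have hIoo : ∀ x y, ν (Ioo x y) = 0 ↔ Ioo x y ∩ M = ∅ := fun x y => by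
    refine ⟨fun h => ?_, fun h =>
      measure_mono_null (show Ioo x y ⊆ Mᶜ from fun z hz hzM => ?_) hνM⟩
    · by_contra hne
      exact hνopen _ isOpen_Ioo (nonempty_iff_ne_empty.2 hne) h
    · exact (eq_empty_iff_forall_notMem.1 h) z ⟨hz, hzM⟩
  have h01 : ν (Ioc 0 1) ≠ 0 := by
    intro h0
    obtain ⟨x, hx⟩ := hne
    have hall : ∀ n : ℤ, ν (Ioc (n : ℝ) (n + 1)) = 0 := fun n => by
      induction n using Int.induction_on with
      | zero => simpa using h0
      | succ n ih => push_cast at ih ⊢; rwa [hνper]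
      | pred n ih =>
        rw [← hνper]
        push_cast at ih ⊢
        simpa using ih
    refine hνopen univ isOpen_univ ⟨x, trivial, hx⟩ ?_
    rw [← iUnion_Ioc_intCast]
    exact measure_iUnion_null hall
  obtain ⟨H, hmono, hone, ⟨c, hc0, hdiff⟩, hcont⟩ := exists_primitive_of_periodic ν hνper h01
  refine ⟨H, hcont hνna, hmono, hone, fun x y hxy => ?_⟩
  rw [← hIoo]
  have h1 := hdiff x y hxy
  have h2 : ν.real (Ioc x y) = 0 ↔ ν (Ioc x y) = 0 := by
    rw [measureReal_def, ENNReal.toReal_eq_zero_iff, or_iff_left measure_Ioc_lt_top.ne]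
  rw [measure_congr (Ioo_ae_eq_Ioc (μ := ν)), ← h2]
  constructor
  · intro h
    rw [h, sub_self] at h1
    exact (mul_eq_zero.1 h1.symm).resolve_left hc0.ne'
  · intro h
    rw [h, mul_zero] at h1
    linarith

section

variable {Γ : Type*} {ρ : Γ → S1 → S1}

/-- The set `M` is nonempty, closed and invariant under all lifts of elements of `ρ(Γ)`. -/
def IsInvariantClosed (ρ : Γ → S1 → S1) (M : Set ℝ) : Prop :=
  M.Nonempty ∧ IsClosed M ∧ ∀ γ F, IsCircleLift (ρ γ) F → MapsTo F M M

/-- A minimal invariant set is either discrete or perfect. -/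
theorem derivedSet_eq_empty_or_preperfect {M : Set ℝ}
    (hM : Minimal (IsInvariantClosed ρ) M) : derivedSet M = ∅ ∨ Preperfect M := by
  rcases eq_empty_or_nonempty (derivedSet M) with h | h
  · exact Or.inl h
  · right
    rw [preperfect_iff_subset_derivedSet]
    refine hM.2 ⟨h, isClosed_derivedSet M, fun γ F hF x hx => ?_⟩
      ((isClosed_iff_derivedSet_subset M).1 hM.1.2.1)
    have h1 : AccPt (F x) (Filter.map F (𝓟 M)) :=
      AccPt.map hx hF.continuous.continuousAt hF.strictMono.injective
    refine AccPt.mono h1 ?_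
    rw [map_principal, principal_mono]
    exact (hM.1.2.2 γ F hF).image_subset

variable [Group Γ]

theorem IsInvariantClosed.add_int_mem (hρ : IsCircleAction Γ ρ) {M : Set ℝ}
    (hM : IsInvariantClosed ρ M) {x : ℝ} (n : ℤ) (hx : x ∈ M) : x + n ∈ M :=
  hM.2.2 1 _ (hρ.lift_add_int n) hx

theorem IsInvariantClosed.nonempty_inter_Icc (hρ : IsCircleAction Γ ρ) {M : Set ℝ}
    (hM : IsInvariantClosed ρ M) : (M ∩ Icc 0 1).Nonempty := by
  obtain ⟨x, hx⟩ := hM.1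
  refine ⟨x + (-⌊x⌋ : ℤ), hM.add_int_mem hρ _ hx, ?_⟩
  push_cast
  constructor <;> linarith [Int.floor_le x, Int.lt_floor_add_one x]

theorem exists_minimal_isInvariantClosed (hρ : IsCircleAction Γ ρ) :
    ∃ M, Minimal (IsInvariantClosed ρ) M := by
  have huniv : IsInvariantClosed ρ univ :=
    ⟨univ_nonempty, isClosed_univ, fun _ _ _ => mapsTo_univ _ _⟩
  suffices hlb : ∀ c ⊆ {M | IsInvariantClosed ρ M}, IsChain (· ⊆ ·) c → c.Nonempty →
      ∃ lb ∈ {M | IsInvariantClosed ρ M}, ∀ s ∈ c, lb ⊆ s by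
    obtain ⟨M, -, hM⟩ := zorn_superset_nonempty _ hlb univ huniv
    exact ⟨M, hM⟩
  intro c hc hchain hne
  refine ⟨⋂₀ c, ⟨?_, isClosed_sInter fun s hs => (hc hs).2.1, fun γ F hF x hx s hs =>
    (hc hs).2.2 γ F hF (hx s hs)⟩, fun s hs => sInter_subset_of_mem hs⟩
  have : Nonempty c := hne.to_subtype
  have hK : (⋂ s : c, (s : Set ℝ) ∩ Icc 0 1).Nonempty := by
    refine IsCompact.nonempty_iInter_of_directed_nonempty_isCompact_isClosed _ ?_
      (fun s => (hc s.2).nonempty_inter_Icc hρ)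
      (fun s => isCompact_Icc.inter_left (hc s.2).2.1)
      (fun s => (hc s.2).2.1.inter isClosed_Icc)
    intro s t
    rcases hchain.total s.2 t.2 with h | h
    · exact ⟨s, Subset.rfl, inter_subset_inter_left _ h⟩
    · exact ⟨t, inter_subset_inter_left _ h, Subset.rfl⟩
  obtain ⟨x, hx⟩ := hK
  exact ⟨x, fun s hs => (mem_iInter.1 hx ⟨s, hs⟩).1⟩

theorem image_Ioo_inter {M : Set ℝ} (hρ : IsCircleAction Γ ρ)
    (hM : IsInvariantClosed ρ M) {γ : Γ} {F : ℝ → ℝ} (hF : IsCircleLift (ρ γ) F) (x y : ℝ) :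
    Ioo (F x) (F y) ∩ M = F '' (Ioo x y ∩ M) := by
  obtain ⟨G, hG, hFG, -⟩ := hρ.exists_lift_inv hF
  ext z
  constructor
  · rintro ⟨hz, hzM⟩
    rw [← hFG z] at hz
    exact ⟨G z, ⟨⟨hF.strictMono.lt_iff_lt.1 hz.1, hF.strictMono.lt_iff_lt.1 hz.2⟩,
      hM.2.2 _ _ hG hzM⟩, hFG z⟩
  · rintro ⟨w, ⟨hw, hwM⟩, rfl⟩
    exact ⟨⟨hF.strictMono hw.1, hF.strictMono hw.2⟩, hM.2.2 _ _ hF hwM⟩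

theorem image_Ioc_inter {M : Set ℝ} (hρ : IsCircleAction Γ ρ)
    (hM : IsInvariantClosed ρ M) {γ : Γ} {F : ℝ → ℝ} (hF : IsCircleLift (ρ γ) F) (x y : ℝ) :
    Ioc (F x) (F y) ∩ M = F '' (Ioc x y ∩ M) := by
  obtain ⟨G, hG, hFG, -⟩ := hρ.exists_lift_inv hF
  ext z
  constructor
  · rintro ⟨hz, hzM⟩
    rw [← hFG z] at hz
    exact ⟨G z, ⟨⟨hF.strictMono.lt_iff_lt.1 hz.1, hF.strictMono.le_iff_le.1 hz.2⟩,
      hM.2.2 _ _ hG hzM⟩, hFG z⟩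
  · rintro ⟨w, ⟨hw, hwM⟩, rfl⟩
    exact ⟨⟨hF.strictMono hw.1, hF.strictMono.monotone hw.2⟩, hM.2.2 _ _ hF hwM⟩

/-- An action with a discrete invariant set is semi-conjugate to an action by rotations. -/
theorem hasRotationFactor_of_derivedSet_eq_empty (hρ : IsCircleAction Γ ρ) {M : Set ℝ}
    (hM : IsInvariantClosed ρ M) (hd : derivedSet M = ∅) : HasRotationFactor ρ := by
  have hfin : ∀ a b, (M ∩ Icc a b).Finite := fun a b => by
    by_contra hinf
    obtain ⟨x, -, hx⟩ := Set.Infinite.exists_accPt_of_subset_isCompact hinf isCompact_Icc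
      inter_subset_right
    have : x ∈ derivedSet M := hx.mono (principal_mono.2 inter_subset_left)
    rw [hd] at this
    exact this
  set ν : Measure ℝ := Measure.count.restrict M with hν
  have happ : ∀ x y, ν (Ioc x y) = (Ioc x y ∩ M).encard := fun x y => by
    rw [hν, Measure.restrict_apply measurableSet_Ioc,
      Measure.count_apply (measurableSet_Ioc.inter hM.2.1.measurableSet)]
  have hmap : ∀ γ F, IsCircleLift (ρ γ) F → ∀ x y, ν (Ioc (F x) (F y)) = ν (Ioc x y) :=
    fun γ F hF x y => by
      rw [happ, happ, image_Ioc_inter hρ hM hF, hF.strictMono.injective.encard_image]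
  have : IsLocallyFiniteMeasure ν := ⟨fun x =>
    ⟨Icc (x - 1) (x + 1), Icc_mem_nhds (by linarith) (by linarith), by
      rw [hν, Measure.restrict_apply measurableSet_Icc, inter_comm]
      exact Measure.count_apply_lt_top.2 (hfin _ _)⟩⟩
  have h01 : ν (Ioc 0 1) ≠ 0 := by
    rw [happ]
    obtain ⟨x, hx⟩ := hM.1
    have hne : (Ioc 0 1 ∩ M).Nonempty := by
      refine ⟨x + ((1 - ⌈x⌉ : ℤ) : ℝ), ?_, hM.add_int_mem hρ _ hx⟩
      push_cast
      constructor <;> linarith [Int.le_ceil x, Int.ceil_lt_add_one x]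
    simpa using hne.ne_empty
  obtain ⟨K, hK, hK1, ⟨c, -, hdiff⟩, -⟩ := exists_primitive_of_periodic ν
    (fun x y => by simpa using hmap 1 _ (hρ.lift_add_int 1) x y) h01
  refine ⟨K, hK, hK1, fun γ F hF x y => ?_⟩
  have key : ∀ x y, x ≤ y → K (F y) - K (F x) = K y - K x := fun x y hxy => by
    rw [hdiff _ _ hxy, hdiff _ _ (hF.strictMono.monotone hxy), measureReal_def, measureReal_def,
      hmap γ F hF]
  rcases le_total x y with h | h
  · exact key x y h
  · linarith [key y x h]

/-- Collapsing the gaps of a perfect minimal invariant set yields a minimal action. -/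
theorem exists_minimal_quasiConj (hρ : IsCircleAction Γ ρ) {M : Set ℝ}
    (hM : Minimal (IsInvariantClosed ρ) M) (hperf : Preperfect M) :
    ∃ ρ₁ : Γ → S1 → S1, IsCircleAction Γ ρ₁ ∧ MinimalAction ρ₁ ∧ QuasiConj ρ ρ₁ := by
  obtain ⟨hne, hclosed, hinv⟩ := hM.1
  obtain ⟨H, hcont, hmono, hone, hH⟩ := hperf.exists_continuous_monotone hclosed hne
    fun x n hx => hM.1.add_int_mem hρ n hx
  have hHn := map_add_int_of_map_add_one hone
  have hsurj := surjective_of_map_add_one hcont hone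
  have hplateau : ∀ γ F, IsCircleLift (ρ γ) F → ∀ x y, H x = H y → H (F x) = H (F y) := by
    intro γ F hF
    have key : ∀ x y, x ≤ y → H x = H y → H (F x) = H (F y) := fun x y hxy h => by
      rw [hH _ _ (hF.strictMono.monotone hxy), image_Ioo_inter hρ hM.1 hF,
        (hH x y hxy).1 h, image_empty]
    intro x y h
    rcases le_total x y with hxy | hxy
    · exact key x y hxy h
    · exact (key y x hxy h.symm).symm
  have hper : Function.Periodic (fun x => (H x : S1)) 1 := fun x => by
    show (H (x + 1) : S1) = H x
    rw [hone]
    simp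
  set h : S1 → S1 := hper.lift
  have hcoe : ∀ x : ℝ, h (x : S1) = (H x : S1) := fun x => hper.lift_coe x
  have hfactor : ∀ γ u v, h u = h v → h (ρ γ u) = h (ρ γ v) := fun γ u v huv => by
    obtain ⟨x, rfl⟩ := QuotientAddGroup.mk_surjective u
    obtain ⟨y, rfl⟩ := QuotientAddGroup.mk_surjective v
    obtain ⟨n, hn⟩ := S1.coe_eq_coe_iff.1 ((hcoe x).symm.trans (huv.trans (hcoe y)))
    obtain ⟨F, hF⟩ := hρ.1 γ
    rw [← hHn] at hn
    have h1 := hplateau γ F hF _ _ hn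
    rw [hF.map_add_int, hHn] at h1
    have h2 : h (ρ γ (x : S1)) = h (ρ γ (y : S1)) := by
      rw [hF.map_coe, hF.map_coe, hcoe, hcoe, h1, S1.coe_add_int]
    exact h2
  have hhsurj : Function.Surjective h := fun u => by
    obtain ⟨t, rfl⟩ := QuotientAddGroup.mk_surjective u
    obtain ⟨x, rfl⟩ := hsurj t
    exact ⟨x, hcoe x⟩
  set σ : S1 → S1 := Function.surjInv hhsurj
  have hσ : ∀ u, h (σ u) = u := Function.surjInv_eq hhsurj
  set ρ₁ : Γ → S1 → S1 := fun γ u => h (ρ γ (σ u)) with hρ₁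
  have hconj : ∀ γ u, ρ₁ γ (h u) = h (ρ γ u) := fun γ u => hfactor γ _ _ (hσ (h u))
  set s : ℝ → ℝ := Function.surjInv hsurj
  have hs : ∀ t, H (s t) = t := Function.surjInv_eq hsurj
  have haction : IsCircleAction Γ ρ₁ := by
    refine ⟨fun γ => ?_, ?_, fun γ η => ?_⟩
    · obtain ⟨F, hF⟩ := hρ.1 γ
      obtain ⟨F', hF', hFF', hF'F⟩ := hρ.exists_lift_inv hF
      refine ⟨fun t => H (F (s t)), fun t u htu => ?_, fun t => ?_, fun t => ?_, fun t => ?_⟩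
      · have hst : s t < s u := lt_of_not_ge fun hle => by
          have := hmono hle
          rw [hs, hs] at this
          exact this.not_gt htu
        refine lt_of_le_of_ne (hmono (hF.strictMono hst).le) fun heq => htu.ne ?_
        have := hplateau _ F' hF' _ _ heq
        rwa [hF'F, hF'F, hs, hs] at this
      · refine ⟨H (F' (s t)), ?_⟩
        have := hplateau _ F hF _ _ (hs (H (F' (s t))))
        simp only
        rw [this, hFF', hs]
      · have h1 : H (s (t + 1)) = H (s t + 1) := by rw [hone, hs, hs]
        simp only
        rw [hplateau _ F hF _ _ h1, hF.map_add_one, hone]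
      · have h1 := hconj γ (s t)
        rw [hcoe, hs, hF.map_coe, hcoe] at h1
        exact h1
    · funext u
      simp only [hρ₁, hρ.map_one_apply, hσ, id]
    · funext u
      have := hconj γ (ρ η (σ u))
      simp only [Function.comp_apply]
      rw [show ρ₁ η u = h (ρ η (σ u)) from rfl, this, ← hρ.map_mul_apply]
  refine ⟨ρ₁, haction, fun u => ?_, h, ⟨H, hmono, hone, hcoe⟩, fun γ =>
    funext fun u => (hconj γ u).symm⟩
  have hHM : ∀ t, ∃ x ∈ M, H x = t := fun t => by
    obtain ⟨x, rfl⟩ := hsurj t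
    have hbdd : BddAbove (M ∩ Iic x) := ⟨x, fun y hy => hy.2⟩
    obtain ⟨y, hy⟩ := hne
    have hne' : (M ∩ Iic x).Nonempty := by
      refine ⟨y + (⌊x - y⌋ : ℤ), hM.1.add_int_mem hρ _ hy, ?_⟩
      simp only [mem_Iic]
      linarith [Int.floor_le (x - y)]
    have hmem := (hclosed.inter isClosed_Iic).csSup_mem hne' hbdd
    refine ⟨_, hmem.1, (hH _ _ hmem.2).2 (eq_empty_of_forall_notMem fun z hz => ?_)⟩
    exact hz.1.1.not_ge (le_csSup hbdd ⟨hz.2, hz.1.2.le⟩)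
  set C : Set S1 := closure (range fun γ => ρ₁ γ u)
  have hcontS : Continuous fun x : ℝ => (H x : S1) :=
    (AddCircle.continuous_mk' 1).comp hcont
  have hCinv : ∀ γ, MapsTo (ρ₁ γ) C C := fun γ => by
    have hcγ : Continuous (ρ₁ γ) := by
      obtain ⟨G, hG⟩ := haction.1 γ
      have : Continuous (ρ₁ γ ∘ fun x : ℝ => (x : S1)) := by
        have e : (ρ₁ γ ∘ fun x : ℝ => (x : S1)) = fun x => (G x : S1) := funext hG.map_coe
        rw [e]
        exact (AddCircle.continuous_mk' 1).comp hG.continuous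
      exact continuous_coinduced_dom.2 this
    refine MapsTo.closure ?_ hcγ
    rintro _ ⟨η, rfl⟩
    exact ⟨γ * η, haction.map_mul_apply γ η u⟩
  have hA : IsInvariantClosed ρ (M ∩ (fun x : ℝ => (H x : S1)) ⁻¹' C) := by
    refine ⟨?_, hclosed.inter (isClosed_closure.preimage hcontS), fun γ F hF x hx =>
      ⟨hinv γ F hF hx.1, ?_⟩⟩
    · obtain ⟨t, rfl⟩ := QuotientAddGroup.mk_surjective u
      obtain ⟨x, hxM, rfl⟩ := hHM t
      exact ⟨x, hxM, subset_closure ⟨1, haction.map_one_apply _⟩⟩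
    · have h1 : ρ₁ γ (H x : S1) ∈ C := hCinv γ hx.2
      rw [← hcoe, hconj, hF.map_coe, hcoe] at h1
      exact h1
  have hsub := hM.2 hA inter_subset_left
  intro v
  obtain ⟨t, rfl⟩ := QuotientAddGroup.mk_surjective v
  obtain ⟨x, hxM, rfl⟩ := hHM t
  exact (hsub hxM).2

end

/-- The real bounded Euler class of `ρ : Γ → Homeo⁺(S¹)` is nonzero if and only if
`ρ` is quasi-conjugate to a minimal unbounded action. -/
theorem realEuler_nonzero_iff_quasiConj_minimal_unbounded
    {Γ : Type*} [Group Γ] (ρ : Γ → S1 → S1) (hρ : IsCircleAction Γ ρ) :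
    ¬ RealEulerVanishes ρ ↔
      ∃ ρ₁ : Γ → S1 → S1, IsCircleAction Γ ρ₁ ∧ MinimalAction ρ₁ ∧ UnboundedAction ρ₁ ∧
        QuasiConj ρ ρ₁ := by
  have hvan := realEulerVanishes_iff_hasRotationFactor hρ
  constructor
  · intro h
    have hrot : ¬ HasRotationFactor ρ := fun hr => h (hvan.2 hr)
    obtain ⟨M, hM⟩ := exists_minimal_isInvariantClosed hρ
    rcases derivedSet_eq_empty_or_preperfect hM with hd | hperf
    · exact absurd (hasRotationFactor_of_derivedSet_eq_empty hρ hM.1 hd) hrot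
    · obtain ⟨ρ₁, hρ₁, hmin, hq⟩ := exists_minimal_quasiConj hρ hM hperf
      exact ⟨ρ₁, hρ₁, hmin, fun he => hrot <|
        (hq.hasRotationFactor_iff hρ hρ₁ hmin).2 (hasRotationFactor_of_equicontinuous hρ₁ he), hq⟩
  · rintro ⟨ρ₁, hρ₁, hmin, hunb, hq⟩ h
    exact hunb <| hmin.equicontinuous_of_hasRotationFactor hρ₁ <|
      (hq.hasRotationFactor_iff hρ hρ₁ hmin).1 (hvan.1 h)

end
end

section
/- Let Γ be a group and ρ : Γ → Homeo⁺(S¹) a minimal unbounded action. Then the centralizer of ρ(Γ) in Homeo⁺(S¹), i.e. {g ∈ Homeo⁺(S¹) : g∘ρ(γ) = ρ(γ)∘g for all γ ∈ Γ}, is a finite cyclic group. -/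
open Filter MeasureTheory Set
open scoped Classical

noncomputable section

/-- The centralizer of `ρ(Γ)` in `Homeo⁺(S¹)`. -/
def ophCentralizer {Γ : Type*} (ρ : Γ → S1 → S1) : Set (S1 → S1) :=
  {g | IsOPH g ∧ ∀ γ : Γ, g ∘ ρ γ = ρ γ ∘ g}

namespace CircleDeg1Lift

theorem units_mul_apply (f g : CircleDeg1Liftˣ) (x : ℝ) :
    ((f * g : CircleDeg1Liftˣ) : CircleDeg1Lift) x = f (g x) := rfl

theorem units_lt_iff_lt (f : CircleDeg1Liftˣ) {x y : ℝ} : f x < f y ↔ x < y :=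
  (toOrderIso f).lt_iff_lt

theorem units_le_iff_le (f : CircleDeg1Liftˣ) {x y : ℝ} : f x ≤ f y ↔ x ≤ y :=
  (toOrderIso f).le_iff_le

theorem units_continuous (f : CircleDeg1Liftˣ) : Continuous f :=
  (toOrderIso f).continuous

theorem units_inv_lt_iff (f : CircleDeg1Liftˣ) {x y : ℝ} :
    (f⁻¹ : CircleDeg1Liftˣ) x < y ↔ x < f y := by
  rw [← units_lt_iff_lt f, units_apply_inv_apply]

theorem units_lt_inv_iff (f : CircleDeg1Liftˣ) {x y : ℝ} :
    x < (f⁻¹ : CircleDeg1Liftˣ) y ↔ f x < y := by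
  rw [← units_lt_iff_lt f, units_apply_inv_apply]

/-- A set of degree one lifts is minimal if all its orbits on the line are dense. -/
def IsMinimalSet (A : Set CircleDeg1Liftˣ) : Prop :=
  ∀ x : ℝ, Dense ((fun F : CircleDeg1Liftˣ => F x) '' A)

variable {A : Set CircleDeg1Liftˣ}

theorem apply_comm_of_mem_centralizer {f F : CircleDeg1Liftˣ} (hf : f ∈ Subgroup.centralizer A)
    (hF : F ∈ A) (x : ℝ) : f (F x) = F (f x) := by
  have h := Subgroup.mem_centralizer_iff.1 hf F hF
  rw [← units_mul_apply, ← units_mul_apply, h]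

theorem translate_one_mem_centralizer (A : Set CircleDeg1Liftˣ) :
    translate (Multiplicative.ofAdd 1) ∈ Subgroup.centralizer A := by
  rw [Subgroup.mem_centralizer_iff]
  intro F _
  ext y
  simp

/-- The centralizer of a minimal set acts freely. -/
theorem eq_one_of_fixed (hA : IsMinimalSet A) {f : CircleDeg1Liftˣ}
    (hf : f ∈ Subgroup.centralizer A) {x : ℝ} (hx : f x = x) : f = 1 := by
  have h : (f : ℝ → ℝ) = id := by
    refine Continuous.ext_on (hA x) (units_continuous f) continuous_id ?_
    rintro _ ⟨F, hF, rfl⟩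
    simp only [id]
    rw [apply_comm_of_mem_centralizer hf hF, hx]
  ext y
  exact congrFun h y

theorem lt_apply_of_lt_apply (hA : IsMinimalSet A) {f : CircleDeg1Liftˣ}
    (hf : f ∈ Subgroup.centralizer A) {x : ℝ} (hx : x < f x) (y : ℝ) : y < f y := by
  by_contra! hy
  obtain ⟨z, hz⟩ := mem_range_of_exists_le_of_exists_ge
    (f := fun z => f z - z) (c := 0) ((units_continuous f).sub continuous_id)
    ⟨y, by linarith⟩ ⟨x, by linarith⟩
  have := eq_one_of_fixed hA hf (sub_eq_zero.1 hz)
  simp [this] at hx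

theorem apply_lt_apply (hA : IsMinimalSet A) {f g : CircleDeg1Liftˣ}
    (hf : f ∈ Subgroup.centralizer A) (hg : g ∈ Subgroup.centralizer A) {x : ℝ}
    (hx : f x < g x) (y : ℝ) : f y < g y := by
  have h := lt_apply_of_lt_apply hA (mul_mem (inv_mem hf) hg) (x := x)
    (by rwa [units_mul_apply, units_lt_inv_iff]) y
  rwa [units_mul_apply, units_lt_inv_iff] at h

/-- The centralizer of `A` moves `x` to the right by arbitrarily small amounts. -/
def HasSmallDisplacement (A : Set CircleDeg1Liftˣ) (x : ℝ) : Prop :=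
  ∀ ε > 0, ∃ f ∈ Subgroup.centralizer A, x < f x ∧ f x < x + ε

theorem HasSmallDisplacement.map {x : ℝ} (h : HasSmallDisplacement A x) {F : CircleDeg1Liftˣ}
    (hF : F ∈ A) : HasSmallDisplacement A (F x) := by
  intro ε hε
  have hlt : x < (F⁻¹ : CircleDeg1Liftˣ) (F x + ε) := by
    rw [units_lt_inv_iff]; linarith
  obtain ⟨f, hf, h1, h2⟩ := h _ (sub_pos.2 hlt)
  refine ⟨f, hf, ?_, ?_⟩
  · rwa [apply_comm_of_mem_centralizer hf hF, units_lt_iff_lt]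
  · rw [apply_comm_of_mem_centralizer hf hF, ← units_lt_inv_iff]
    linarith

theorem HasSmallDisplacement.all (hA : IsMinimalSet A) {x : ℝ} (h : HasSmallDisplacement A x)
    (y : ℝ) : HasSmallDisplacement A y := by
  intro ε hε
  obtain ⟨_, ⟨F, hF, rfl⟩, h1, h2⟩ := (hA x).exists_between (show y < y + ε / 2 by linarith)
  obtain ⟨f, hf, h3, h4⟩ := h.map hF (ε / 2) (by linarith)
  refine ⟨f, hf, lt_apply_of_lt_apply hA hf h3 y, ?_⟩
  have := (units_lt_iff_lt f).2 h1
  linarith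

theorem HasSmallDisplacement.exists_uniform (hA : IsMinimalSet A) {x : ℝ}
    (h : HasSmallDisplacement A x) {ε : ℝ} (hε : 0 < ε) :
    ∃ f ∈ Subgroup.centralizer A, ∀ y, y < f y ∧ f y < y + ε := by
  have key : ∃ f ∈ Subgroup.centralizer A, 0 < f 0 ∧ ∀ y ∈ Icc (0 : ℝ) 1, f y < y + ε := by
    refine isCompact_Icc.induction_on
      (p := fun s => ∃ f ∈ Subgroup.centralizer A, 0 < f 0 ∧ ∀ y ∈ s, f y < y + ε) ?_ ?_ ?_ ?_
    · obtain ⟨f, hf, h1, -⟩ := h.all hA 0 1 one_pos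
      exact ⟨f, hf, h1, by simp⟩
    · rintro s t hst ⟨f, hf, h1, h2⟩
      exact ⟨f, hf, h1, fun y hy => h2 y (hst hy)⟩
    · rintro s t ⟨f, hf, hf1, hf2⟩ ⟨g, hg, hg1, hg2⟩
      rcases lt_trichotomy (f 0) (g 0) with hfg | hfg | hfg
      · refine ⟨f, hf, hf1, ?_⟩
        rintro y (hy | hy)
        · exact hf2 y hy
        · exact (apply_lt_apply hA hf hg hfg y).trans (hg2 y hy)
      · have : g⁻¹ * f = 1 := eq_one_of_fixed hA (mul_mem (inv_mem hg) hf) (x := 0)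
          (by rw [units_mul_apply, hfg, units_inv_apply_apply])
        obtain rfl := inv_mul_eq_one.1 this
        refine ⟨g, hg, hf1, ?_⟩
        rintro y (hy | hy)
        · exact hf2 y hy
        · exact hg2 y hy
      · refine ⟨g, hg, hg1, ?_⟩
        rintro y (hy | hy)
        · exact (apply_lt_apply hA hg hf hfg y).trans (hf2 y hy)
        · exact hg2 y hy
    · intro y _
      obtain ⟨f, hf, h1, h2⟩ := h.all hA y ε hε
      refine ⟨{z | f z < z + ε}, mem_nhdsWithin_of_mem_nhds ?_, f, hf,
        lt_apply_of_lt_apply hA hf h1 0, fun z hz => hz⟩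
      exact (isOpen_lt (units_continuous f) (continuous_id.add continuous_const)).mem_nhds h2
  obtain ⟨f, hf, h1, h2⟩ := key
  refine ⟨f, hf, fun y => ⟨lt_apply_of_lt_apply hA hf h1 y, ?_⟩⟩
  have h3 := h2 (Int.fract y) ⟨Int.fract_nonneg y, (Int.fract_lt_one y).le⟩
  have h4 := map_fract_sub_fract_eq f y
  linarith

/-- If the centralizer of a minimal set has small displacements then the set is
equicontinuous. -/
theorem HasSmallDisplacement.eventually_forall_dist_lt (hA : IsMinimalSet A) {x : ℝ}
    (h : HasSmallDisplacement A x) (a : ℝ) {ε : ℝ} (hε : 0 < ε) :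
    ∀ᶠ b in nhds a, ∀ F ∈ A, dist (F a) (F b) < ε := by
  obtain ⟨f, hf, h1⟩ := h.exists_uniform hA hε
  have h2 : (f⁻¹ : CircleDeg1Liftˣ) a < a := by rw [units_inv_lt_iff]; exact (h1 a).1
  filter_upwards [Ioo_mem_nhds h2 (h1 a).1] with b hb F hF
  have h3 := (units_lt_iff_lt F).2 ((units_inv_lt_iff f).1 hb.1)
  have h4 := (units_lt_iff_lt F).2 hb.2
  rw [← apply_comm_of_mem_centralizer hf hF] at h3 h4
  have h5 := (h1 (F a)).2
  have h6 := (h1 (F b)).2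
  rw [Real.dist_eq, abs_lt]
  constructor <;> linarith

/-- If the centralizer of a minimal set has no small displacements, it has a smallest
positive element. -/
theorem exists_least_pos (h : ∀ x, ¬ HasSmallDisplacement A x) (hA : IsMinimalSet A) :
    ∃ z ∈ Subgroup.centralizer A, 0 < z 0 ∧
      ∀ f ∈ Subgroup.centralizer A, 0 < f 0 → z 0 ≤ f 0 := by
  set S : Set ℝ := {y | ∃ f ∈ Subgroup.centralizer A, 0 < f 0 ∧ f 0 = y}
  have hne : S.Nonempty := by
    refine ⟨1, translate (Multiplicative.ofAdd 1), translate_one_mem_centralizer A, by simp, by simp⟩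
  have hbdd : BddBelow S := ⟨0, by rintro _ ⟨f, -, h1, rfl⟩; exact h1.le⟩
  have hS' : ∀ f ∈ Subgroup.centralizer A, 0 < f 0 → sInf S ≤ f 0 := fun f hf h0 =>
    csInf_le hbdd ⟨f, hf, h0, rfl⟩
  have ha := h (sInf S)
  simp only [HasSmallDisplacement] at ha
  push Not at ha
  obtain ⟨ε, hε, ha⟩ := ha
  obtain ⟨_, ⟨z, hz, hz0, rfl⟩, hlt⟩ := exists_lt_of_csInf_lt hne
    (show sInf S < sInf S + ε by linarith)
  refine ⟨z, hz, hz0, fun f hf hf0 => ?_⟩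
  by_contra! hfz
  have h1 : sInf S ≤ ((f⁻¹ * z : CircleDeg1Liftˣ) : CircleDeg1Lift) 0 :=
    hS' _ (mul_mem (inv_mem hf) hz) (by rwa [units_mul_apply, units_lt_inv_iff])
  rw [← units_le_iff_le f, units_mul_apply, units_apply_inv_apply] at h1
  have h2 := ha f hf (lt_apply_of_lt_apply hA hf hf0 _)
  linarith

theorem exists_lt_pow_apply (z : CircleDeg1Liftˣ) (hz : ∀ x, x < z x) (y : ℝ) :
    ∃ n : ℕ, y < (z ^ n : CircleDeg1Liftˣ) 0 := by
  by_contra! hy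
  have hb : BddAbove (range fun n : ℕ => (z ^ n : CircleDeg1Liftˣ) 0) :=
    ⟨y, by rintro _ ⟨n, rfl⟩; exact hy n⟩
  set L := ⨆ n : ℕ, (z ^ n : CircleDeg1Liftˣ) 0
  obtain ⟨n, hn⟩ := exists_lt_of_lt_ciSup ((units_inv_lt_iff z).2 (hz L))
  rw [units_inv_lt_iff, ← units_mul_apply, ← pow_succ'] at hn
  exact (le_ciSup hb (n + 1)).not_gt hn

theorem exists_eq_zpow (hA : IsMinimalSet A) {z : CircleDeg1Liftˣ}
    (hz : z ∈ Subgroup.centralizer A) (hz0 : 0 < z 0)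
    (hmin : ∀ f ∈ Subgroup.centralizer A, 0 < f 0 → z 0 ≤ f 0)
    {f : CircleDeg1Liftˣ} (hf : f ∈ Subgroup.centralizer A) : ∃ n : ℤ, f = z ^ n := by
  have nonneg : ∀ f ∈ Subgroup.centralizer A, 0 ≤ f 0 → ∃ n : ℕ, f = z ^ n := by
    intro f hf hf0
    have hex := exists_lt_pow_apply z (lt_apply_of_lt_apply hA hz hz0) (f 0)
    obtain ⟨m, hm⟩ : ∃ m, Nat.find hex = m + 1 := by
      refine Nat.exists_eq_succ_of_ne_zero fun h0 => ?_
      have := Nat.find_spec hex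
      rw [h0, pow_zero] at this
      exact hf0.not_gt this
    have h1 := Nat.find_spec hex
    have h2 := Nat.find_min hex (m := m) (by omega)
    rw [hm] at h1
    rw [not_lt] at h2
    have hg : (z ^ m)⁻¹ * f ∈ Subgroup.centralizer A := mul_mem (inv_mem (pow_mem hz m)) hf
    refine ⟨m, (inv_mul_eq_one.1 (eq_one_of_fixed hA hg (x := 0) ?_)).symm⟩
    rw [units_mul_apply]
    refine le_antisymm ?_ ?_
    · by_contra! h3
      have h4 := hmin _ hg h3
      rw [units_mul_apply, ← units_le_iff_le (z ^ m), units_apply_inv_apply, ← units_mul_apply,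
        ← pow_succ] at h4
      exact h4.not_gt h1
    · rwa [← units_le_iff_le (z ^ m), units_apply_inv_apply]
  rcases le_total 0 (f 0) with h0 | h0
  · obtain ⟨n, rfl⟩ := nonneg f hf h0
    exact ⟨n, (zpow_natCast z n).symm⟩
  · obtain ⟨n, hn⟩ := nonneg f⁻¹ (inv_mem hf)
      (by rwa [← units_le_iff_le f, units_apply_inv_apply])
    exact ⟨-n, by rw [zpow_neg, zpow_natCast, ← hn, inv_inv]⟩

/-- Lifts of commuting circle homeomorphisms commute. -/
theorem commute_of_coe_eq (F G : CircleDeg1Liftˣ)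
    (h : ∀ x : ℝ, ((F (G x) : ℝ) : S1) = ((G (F x) : ℝ) : S1)) : Commute F G := by
  have hint : ∀ x : ℝ, ∃ n : ℤ, (n : ℝ) = F (G x) - G (F x) := by
    intro x
    obtain ⟨n, hn⟩ := (QuotientAddGroup.eq_iff_sub_mem.1 (h x))
    exact ⟨n, by simpa using hn⟩
  choose k hk using hint
  have hcont : Continuous k := by
    rw [Int.isClosedEmbedding_coe_real.isInducing.continuous_iff]
    have : ((↑) : ℤ → ℝ) ∘ k = fun x => F (G x) - G (F x) := funext hk
    rw [this]
    exact ((units_continuous F).comp (units_continuous G)).sub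
      ((units_continuous G).comp (units_continuous F))
  have hconst : ∀ x, k x = k 0 := fun x => PreconnectedSpace.constant inferInstance hcont
  have heq : (F * G * F⁻¹ : CircleDeg1Liftˣ)
      = translate (Multiplicative.ofAdd (k 0 : ℝ)) * G := by
    rw [mul_inv_eq_iff_eq_mul]
    ext x
    have := hk x
    rw [hconst] at this
    simp only [units_mul_apply, translate_apply]
    linarith
  have htr : Commute ((translate (Multiplicative.ofAdd (k 0 : ℝ)) : CircleDeg1Liftˣ) :
      CircleDeg1Lift) G := by
    ext x
    simp
  have h0 : (k 0 : ℝ) = 0 := by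
    have h1 := translationNumber_conj_eq F G
    rw [← Units.val_mul, ← Units.val_mul, heq, Units.val_mul,
      translationNumber_mul_of_commute htr, translationNumber_translate] at h1
    linarith
  have h1 : F * G * F⁻¹ = G := by rw [heq, h0]; simp
  exact mul_inv_eq_iff_eq_mul.1 h1

end CircleDeg1Lift

open CircleDeg1Lift in
theorem IsOPH.exists_units {f : S1 → S1} (hf : IsOPH f) :
    ∃ F : CircleDeg1Liftˣ, ∀ x : ℝ, f (x : S1) = ((F x : ℝ) : S1) := by
  obtain ⟨F, h1, h2, h3, h4⟩ := hf
  obtain ⟨u, hu⟩ := isUnit_iff_bijective (f := ⟨⟨F, h1.monotone⟩, h3⟩).2 ⟨h1.injective, h2⟩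
  exact ⟨u, fun x => by rw [hu]; exact h4 x⟩

namespace CircleDeg1Lift

/-- The circle map induced by a degree one lift. -/
def toCircleMap (F : CircleDeg1Lift) : S1 → S1 :=
  Function.Periodic.lift (f := fun x : ℝ => ((F x : ℝ) : S1)) (c := 1) fun x => by
    simp only [map_add_one]
    exact AddCircle.coe_add_period 1 (F x)

@[simp]
theorem toCircleMap_coe (F : CircleDeg1Lift) (x : ℝ) : F.toCircleMap (x : S1) = (F x : ℝ) := rfl

theorem eq_toCircleMap {f : S1 → S1} {F : CircleDeg1Lift}
    (h : ∀ x : ℝ, f (x : S1) = ((F x : ℝ) : S1)) : f = F.toCircleMap := by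
  funext x
  induction x using QuotientAddGroup.induction_on with
  | H x => exact h x

theorem toCircleMap_mul (F G : CircleDeg1Lift) :
    (F * G).toCircleMap = F.toCircleMap ∘ G.toCircleMap :=
  (eq_toCircleMap fun _ => rfl).symm

theorem toCircleMap_pow (F : CircleDeg1Lift) (n : ℕ) :
    (F ^ n).toCircleMap = F.toCircleMap^[n] := by
  induction n with
  | zero => exact (eq_toCircleMap fun _ => rfl).symm
  | succ n ih => rw [pow_succ, toCircleMap_mul, ih, Function.iterate_succ]

theorem isOPH_toCircleMap (F : CircleDeg1Liftˣ) : IsOPH (F : CircleDeg1Lift).toCircleMap :=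
  ⟨F, (toOrderIso F).strictMono, (toOrderIso F).surjective, map_add_one _, fun _ => rfl⟩

theorem toCircleMap_translate_int (n : ℤ) :
    (translate (Multiplicative.ofAdd (n : ℝ)) : CircleDeg1Lift).toCircleMap = id := by
  refine (eq_toCircleMap fun x => ?_).symm
  have h : ((n : ℝ) : S1) = 0 := (AddCircle.coe_eq_zero_iff 1).2 ⟨n, by simp⟩
  rw [translate_apply, id, AddCircle.coe_add, h, zero_add]

end CircleDeg1Lift

open CircleDeg1Lift

/-- The set of all lifts to the line of elements of an action on the circle. -/
def actionLifts {Γ : Type*} (ρ : Γ → S1 → S1) : Set CircleDeg1Liftˣ :=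
  {F | ∃ γ, ρ γ = (F : CircleDeg1Lift).toCircleMap}

theorem MinimalAction.isMinimalSet_actionLifts {Γ : Type*} {ρ : Γ → S1 → S1}
    (hmin : MinimalAction ρ) (hρ : ∀ γ, IsOPH (ρ γ)) : IsMinimalSet (actionLifts ρ) := by
  intro x
  refine ((hmin x).preimage
    (QuotientAddGroup.isOpenMap_coe (N := AddSubgroup.zmultiples (1 : ℝ)))).mono ?_
  rintro y ⟨γ, hγ⟩
  obtain ⟨F, hF⟩ := (hρ γ).exists_units
  simp only [hF] at hγ
  obtain ⟨n, hn⟩ := QuotientAddGroup.eq_iff_sub_mem.1 hγ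
  refine ⟨translate (Multiplicative.ofAdd ((-n : ℤ) : ℝ)) * F, ⟨γ, ?_⟩, ?_⟩
  · rw [Units.val_mul, toCircleMap_mul, toCircleMap_translate_int]
    exact eq_toCircleMap hF
  · have hn' : (n : ℝ) = F x - y := by simpa using hn
    simp only [units_mul_apply, translate_apply]
    push_cast
    linarith

theorem mem_ophCentralizer_iff {Γ : Type*} {ρ : Γ → S1 → S1} (hρ : ∀ γ, IsOPH (ρ γ))
    {g : S1 → S1} : g ∈ ophCentralizer ρ ↔
      ∃ G ∈ Subgroup.centralizer (actionLifts ρ), g = (G : CircleDeg1Lift).toCircleMap := by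
  constructor
  · rintro ⟨hg, hcomm⟩
    obtain ⟨G, hG⟩ := hg.exists_units
    refine ⟨G, ?_, eq_toCircleMap hG⟩
    rw [Subgroup.mem_centralizer_iff]
    rintro F ⟨γ, hF⟩
    refine commute_of_coe_eq F G fun x => ?_
    have := congrFun (hcomm γ) (x : S1)
    simp only [Function.comp_apply, hF, hG, toCircleMap_coe] at this
    exact this.symm
  · rintro ⟨G, hG, rfl⟩
    refine ⟨isOPH_toCircleMap G, fun γ => ?_⟩
    obtain ⟨F, hF⟩ := (hρ γ).exists_units
    have hF := eq_toCircleMap hF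
    have := Subgroup.mem_centralizer_iff.1 hG F ⟨γ, hF⟩
    rw [hF, ← toCircleMap_mul, ← toCircleMap_mul, ← Units.val_mul, ← Units.val_mul, this]

theorem equicontinuous_of_hasSmallDisplacement {Γ : Type*} {ρ : Γ → S1 → S1}
    (hmin : MinimalAction ρ) (hρ : ∀ γ, IsOPH (ρ γ)) {x : ℝ}
    (h : HasSmallDisplacement (actionLifts ρ) x) : Equicontinuous ρ := by
  intro s
  induction s using QuotientAddGroup.induction_on with
  | H a =>
    rw [Metric.equicontinuousAt_iff_right]
    intro ε hε
    rw [← (QuotientAddGroup.isOpenQuotientMap_mk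
      (N := AddSubgroup.zmultiples (1 : ℝ))).map_nhds_eq, eventually_map]
    filter_upwards [h.eventually_forall_dist_lt (hmin.isMinimalSet_actionLifts hρ) a hε] with b hb γ
    obtain ⟨F, hF⟩ := (hρ γ).exists_units
    refine lt_of_le_of_lt ?_ (hb F ⟨γ, eq_toCircleMap hF⟩)
    rw [hF, hF, dist_eq_norm, dist_eq_norm, ← AddCircle.coe_sub]
    exact QuotientAddGroup.norm_mk_le_norm

/-- If `ρ : Γ → Homeo⁺(S¹)` is minimal and unbounded, then the centralizer of `ρ(Γ)`
in `Homeo⁺(S¹)` is a finite cyclic group: it is finite and generated (under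
composition) by a single element. -/
theorem centralizer_of_minimal_unbounded_is_finite_cyclic
    {Γ : Type*} [Group Γ] (ρ : Γ → S1 → S1) (hρ : IsCircleAction Γ ρ)
    (hmin : MinimalAction ρ) (hunb : UnboundedAction ρ) :
    (ophCentralizer ρ).Finite ∧
      ∃ g₀ ∈ ophCentralizer ρ, ∀ g ∈ ophCentralizer ρ, ∃ n : ℕ, g = g₀^[n] := by
  have hoph := hρ.1
  have hA := hmin.isMinimalSet_actionLifts hoph
  obtain ⟨z, hz, hz0, hzmin⟩ := exists_least_pos
    (fun _ h => hunb (equicontinuous_of_hasSmallDisplacement hmin hoph h)) hA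
  obtain ⟨m, hm⟩ := exists_eq_zpow hA hz hz0 hzmin (translate_one_mem_centralizer _)
  have hm0 : m ≠ 0 := by
    rintro rfl
    have := congrArg (fun u : CircleDeg1Liftˣ => u 0) hm
    simp at this
  have key : ∀ g ∈ ophCentralizer ρ,
      ∃ n < m.natAbs, (z : CircleDeg1Lift).toCircleMap^[n] = g := by
    intro g hg
    obtain ⟨G, hG, rfl⟩ := (mem_ophCentralizer_iff hoph).1 hg
    obtain ⟨k, rfl⟩ := exists_eq_zpow hA hz hz0 hzmin hG
    have h1 := Int.emod_nonneg k hm0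
    have h2 := Int.emod_lt k hm0
    refine ⟨(k % m).toNat, by omega, ?_⟩
    have h3 : z ^ k =
        translate (Multiplicative.ofAdd ((k / m : ℤ) : ℝ)) * z ^ (k % m).toNat := by
      rw [← zpow_natCast, Int.toNat_of_nonneg h1, ← mul_one ((k / m : ℤ) : ℝ), ← translate_zpow,
        hm, ← zpow_mul, ← zpow_add, Int.mul_ediv_add_emod]
    rw [h3, Units.val_mul, toCircleMap_mul, toCircleMap_translate_int, Units.val_pow_eq_pow_val,
      toCircleMap_pow]
    rfl
  refine ⟨((Set.finite_lt_nat m.natAbs).image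
    fun n => (z : CircleDeg1Lift).toCircleMap^[n]).subset fun g hg => ?_,
    (z : CircleDeg1Lift).toCircleMap, (mem_ophCentralizer_iff hoph).2 ⟨z, hz, rfl⟩,
    fun g hg => ?_⟩
  · obtain ⟨n, hn, h⟩ := key g hg
    exact ⟨n, hn, h⟩
  · obtain ⟨n, -, h⟩ := key g hg
    exact ⟨n, h.symm⟩

end
end

section
/- Let Γ be a group, ρ, ρ₀ : Γ → Homeo⁺(S¹) homomorphisms with ρ minimal, and φ : S¹ → S¹ a continuous non-constant map satisfying φ∘ρ(γ) = ρ₀(γ)∘φ for all γ ∈ Γ. Then φ is surjective, and φ admits no continuous lift to ℝ: there is no continuous ψ : S¹ → ℝ with φ = p∘ψ, where p : ℝ → ℝ/ℤ is the projection (equivalently, the degree of φ is nonzero). -/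
open Filter MeasureTheory Set
open scoped Classical

noncomputable section

lemma IsCircleLift.continuous_s10 {f : S1 → S1} {F : ℝ → ℝ} (h : IsCircleLift f F) :
    Continuous F :=
  h.1.monotone.continuous_of_surjective h.2.1

lemma IsOPH.continuous_s10 {f : S1 → S1} (h : IsOPH f) : Continuous f := by
  obtain ⟨F, hF⟩ := h
  refine continuous_coinduced_dom.2 ?_
  have : f ∘ (fun x : ℝ => (x : S1)) = fun x : ℝ => (F x : S1) := funext hF.2.2.2
  exact this ▸ (AddCircle.continuous_mk' 1).comp hF.continuous_s10

/-- Two continuous real functions on a preconnected space which agree modulo `ℤ` differ by a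
constant. -/
lemma exists_eq_add_const_of_coe_eq {X : Type*} [TopologicalSpace X] [PreconnectedSpace X]
    [Nonempty X] {u v : X → ℝ} (hu : Continuous u) (hv : Continuous v)
    (h : ∀ x, (u x : S1) = (v x : S1)) : ∃ c : ℝ, ∀ x, u x = v x + c := by
  have hk : ∀ x, ∃ k : ℤ, (k : ℝ) = u x - v x := fun x => by
    have h0 : ((u x - v x : ℝ) : S1) = 0 := by
      rw [AddCircle.coe_sub, h x, sub_self]
    obtain ⟨k, hk⟩ := (AddCircle.coe_eq_zero_iff 1).1 h0
    exact ⟨k, by simpa using hk⟩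
  choose k hk using hk
  have hkc : Continuous k := by
    rw [Int.isClosedEmbedding_coe_real.isEmbedding.continuous_iff]
    exact (hu.sub hv).congr fun x => (hk x).symm
  obtain ⟨x₀⟩ := ‹Nonempty X›
  refine ⟨k x₀, fun x => ?_⟩
  rw [← PreconnectedSpace.constant ‹_› hkc (x := x) (y := x₀), hk]
  ring

/-- A continuous map to the circle which omits a point lifts to `ℝ`. -/
lemma exists_continuous_lift_of_notMem_range {X : Type*} [TopologicalSpace X] {φ : X → S1}
    (hφ : Continuous φ) {y : S1} (hy : y ∉ range φ) :
    ∃ ψ : X → ℝ, Continuous ψ ∧ φ = fun x => ((ψ x : ℝ) : S1) := by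
  obtain ⟨t, rfl⟩ := QuotientAddGroup.mk_surjective y
  refine ⟨fun x => AddCircle.equivIco 1 t (φ x), continuous_iff_continuousAt.2 fun x => ?_,
    funext fun x => (AddCircle.coe_equivIco).symm⟩
  have hx : φ x ≠ (t : S1) := fun h => hy ⟨x, h⟩
  exact continuous_subtype_val.continuousAt.comp
    ((AddCircle.continuousAt_equivIco 1 t hx).comp hφ.continuousAt)

/-- A factor map of a minimal circle action which lifts to `ℝ` is constant: its lift is constantly
equal to its maximum. -/
lemma MinimalAction.factor_const_of_lift {Γ : Type*} [Group Γ] {ρ ρ₀ : Γ → S1 → S1}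
    (hρ : IsCircleAction Γ ρ) (hρ₀ : ∀ γ, IsOPH (ρ₀ γ)) (hmin : MinimalAction ρ)
    {ψ : S1 → ℝ} (hψ : Continuous ψ)
    (hequiv : ∀ γ x, ((ψ (ρ γ x) : ℝ) : S1) = ρ₀ γ (ψ x : S1)) :
    ∃ b : ℝ, ∀ x, ψ x = b := by
  obtain ⟨x₀, hx₀⟩ : ∃ x₀, ∀ x, ψ x ≤ ψ x₀ := by
    obtain ⟨x₀, -, h⟩ := isCompact_univ.exists_isMaxOn univ_nonempty hψ.continuousOn
    exact ⟨x₀, fun x => h (mem_univ x)⟩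
  have horbit : ∀ γ, ψ (ρ γ x₀) = ψ x₀ := fun γ => by
    obtain ⟨G, hG⟩ := hρ₀ γ
    obtain ⟨c, hc⟩ := exists_eq_add_const_of_coe_eq
      (hψ.comp (hρ.1 γ).continuous_s10) (hG.continuous_s10.comp hψ)
      fun x => (hequiv γ x).trans (hG.2.2.2 _)
    simp only [Function.comp_apply] at hc
    refine le_antisymm (hx₀ _) ?_
    have hinv : ρ γ (ρ γ⁻¹ x₀) = x₀ := by
      rw [← Function.comp_apply (f := ρ γ), ← hρ.2.2, mul_inv_cancel, hρ.2.1, id]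
    calc ψ x₀ = G (ψ (ρ γ⁻¹ x₀)) + c := by rw [← hc, hinv]
      _ ≤ G (ψ x₀) + c := by gcongr; exact hG.1.monotone (hx₀ _)
      _ = ψ (ρ γ x₀) := (hc x₀).symm
  refine ⟨ψ x₀, fun x => ?_⟩
  exact congrFun (hψ.ext_on (hmin x₀) continuous_const (by rintro _ ⟨γ, rfl⟩; exact horbit γ)) x

/-- If `ρ` is minimal and `(φ, ρ₀)` is a non-trivial `S¹`-factor of `ρ`, then `φ` is
surjective and has nonzero degree, i.e. `φ` admits no continuous lift `S¹ → ℝ`. -/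
theorem factor_map_of_minimal_is_surjective_of_nonzero_degree
    {Γ : Type*} [Group Γ] (ρ ρ₀ : Γ → S1 → S1)
    (hρ : IsCircleAction Γ ρ) (hρ₀ : IsCircleAction Γ ρ₀)
    (hmin : MinimalAction ρ)
    (φ : S1 → S1) (hcont : Continuous φ) (hnc : ¬ ∃ c : S1, φ = fun _ => c)
    (hequiv : ∀ γ : Γ, φ ∘ ρ γ = ρ₀ γ ∘ φ) :
    Function.Surjective φ ∧
      ¬ ∃ ψ : S1 → ℝ, Continuous ψ ∧ φ = fun x => ((ψ x : ℝ) : S1) := by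
  have hlift : ¬ ∃ ψ : S1 → ℝ, Continuous ψ ∧ φ = fun x => ((ψ x : ℝ) : S1) := by
    rintro ⟨ψ, hψ, rfl⟩
    obtain ⟨b, hb⟩ := hmin.factor_const_of_lift hρ hρ₀.1 hψ fun γ x => congrFun (hequiv γ) x
    exact hnc ⟨b, funext fun x => by rw [hb]⟩
  refine ⟨fun y => ?_, hlift⟩
  by_contra hy
  exact hlift (exists_continuous_lift_of_notMem_range hcont hy)

end
end
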